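/- arXiv:2009.04921 — 3 statements merged into one kernel-verified Lean document; each statement's English description precedes it below -/
import Mathlib

section
/- Let m ∈ ℕ, R > 0, and let v be a continuous nonnegative function on the closed ball B̄(0,R) ⊂ ℝᵐ whose restriction to the open ball B(0,R) is subharmonic. Then for every x' ∈ B(0,R): v(x') ≤ ((R + |x'|) R^{m−2} / (R − |x'|)^{m−1}) · 𝐒_v(0, R). -/
open MeasureTheory Metric Filter Set
open scoped ENNReal NNReal Topology

noncomputable section

/-- `ℝᵐ` as the Euclidean space `EuclideanSpace ℝ (Fin m)`. -/
abbrev Em (m : ℕ) := EuclideanSpace ℝ (Fin m)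

/-- The positive-part valued `ℝ≥0∞` of an extended real. -/
def EReal.toENNReal' (x : EReal) : ℝ≥0∞ :=
  if x = ⊤ then ⊤ else ENNReal.ofReal x.toReal

/-- Integral of an `EReal`-valued function: difference of the lower integrals of
the positive and the negative parts. -/
def eIntegral {α : Type*} [MeasurableSpace α] (μ : Measure α) (f : α → EReal) : EReal :=
  ((∫⁻ x, (f x).toENNReal' ∂μ : ℝ≥0∞) : EReal) - ((∫⁻ x, (-(f x)).toENNReal' ∂μ : ℝ≥0∞) : EReal)

/-- Integrability of an `EReal`-valued function. -/
def EIntegrable {α : Type*} [MeasurableSpace α] (μ : Measure α) (f : α → EReal) : Prop :=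
  Measurable f ∧ (∫⁻ x, (f x).toENNReal' ∂μ) < ⊤ ∧ (∫⁻ x, (-(f x)).toENNReal' ∂μ) < ⊤

/-- Surface (area) measure on the sphere of radius `t` centered at `x` in `ℝᵐ`:
the `(m-1)`-dimensional Hausdorff measure restricted to the sphere. -/
def sphereMeasure (m : ℕ) (x : Em m) (t : ℝ) : Measure (Em m) :=
  (μH[(m : ℝ) - 1]).restrict (Metric.sphere x t)

/-- `s_{m-1}`: the surface area of the unit sphere in `ℝᵐ`. -/
def sphereArea (m : ℕ) : ℝ :=
  (μH[(m : ℝ) - 1] (Metric.sphere (0 : Em m) 1)).toReal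

/-- `b_m`: the volume of the unit ball in `ℝᵐ`. -/
def ballVolume (m : ℕ) : ℝ :=
  (volume (Metric.closedBall (0 : Em m) 1)).toReal

/-- Mean of an `EReal`-valued function over the sphere `S(x,t) ⊂ ℝᵐ`. -/
def sMean (m : ℕ) (v : Em m → EReal) (x : Em m) (t : ℝ) : EReal :=
  ((1 / (sphereArea m * t ^ (m - 1)) : ℝ) : EReal) * eIntegral (sphereMeasure m x t) v

/-- Mean of an `EReal`-valued function over the closed ball `B̄(x,t) ⊂ ℝᵐ`. -/
def bMean (m : ℕ) (v : Em m → EReal) (x : Em m) (t : ℝ) : EReal :=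
  ((1 / (ballVolume m * t ^ m) : ℝ) : EReal) *
    eIntegral (volume.restrict (Metric.closedBall x t)) v

/-- A function is subharmonic on a set `U ⊆ ℝᵐ`: it is upper semicontinuous on `U`,
takes values in `[-∞, +∞)` on `U`, and satisfies the sub-mean inequality over every
sphere whose corresponding closed ball lies in `U`. -/
def SubharmonicOn (m : ℕ) (v : Em m → EReal) (U : Set (Em m)) : Prop :=
  UpperSemicontinuousOn v U ∧ (∀ x ∈ U, v x ≠ ⊤) ∧
    ∀ x ∈ U, ∀ t : ℝ, 0 < t → Metric.closedBall x t ⊆ U → v x ≤ sMean m v x t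

/-- The order (at `∞`) of an `EReal`-valued function on a normed space:
`limsup_{|x|→∞} ln(1 + v⁺(x)) / ln |x|`. -/
def ordE {V : Type*} [NormedAddCommGroup V] (v : V → EReal) : EReal :=
  Filter.limsup
    (fun x => ((Real.log (1 + max (v x).toReal 0) / Real.log ‖x‖ : ℝ) : EReal))
    (Bornology.cobounded V)

/-- The order (at `∞`) of a real-valued function on a normed space. -/
def ordR {V : Type*} [NormedAddCommGroup V] (v : V → ℝ) : EReal :=
  Filter.limsup
    (fun x => ((Real.log (1 + max (v x) 0) / Real.log ‖x‖ : ℝ) : EReal))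
    (Bornology.cobounded V)

/-- Mean of a real-valued function over the sphere `S(x,t) ⊂ ℝᵐ` with respect to the
surface measure. -/
def rSMean (m : ℕ) (v : Em m → ℝ) (x : Em m) (t : ℝ) : ℝ :=
  (1 / (sphereArea m * t ^ (m - 1))) *
    ∫ y, v y ∂((μH[(m : ℝ) - 1]).restrict (Metric.sphere x t))

lemma exists_abs_one_add_rpow_sub_le (p : ℝ) : ∃ C η : ℝ, 0 < C ∧ 0 < η ∧ ∀ τ : ℝ, |τ| ≤ η →
    |(1 + τ) ^ p - (1 + p * τ + p * (p - 1) / 2 * τ ^ 2)| ≤ C * |τ| ^ 3 := by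
  have h := (Real.one_add_rpow_hasFPowerSeriesAt_zero (a := p)).isBigO_sub_partialSum_pow 3
  obtain ⟨C, hC, hb⟩ := h.exists_pos
  obtain ⟨η, hη, hb⟩ := Metric.eventually_nhds_iff.1 hb.bound
  refine ⟨C, η / 2, hC, by positivity, fun τ hτ ↦ ?_⟩
  have := hb (y := τ) (by rw [dist_zero_right, Real.norm_eq_abs]; linarith)
  have h2 : Ring.choose p 2 = p * (p - 1) / 2 := by
    have := Ring.descPochhammer_eq_factorial_smul_choose p 2
    simp [descPochhammer_succ_right, Nat.factorial, Polynomial.smeval_mul, Polynomial.smeval_sub,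
      Polynomial.smeval_X, Polynomial.smeval_one] at this
    linarith
  simpa [FormalMultilinearSeries.partialSum, Finset.sum_range_succ, binomialSeries, h2, mul_comm,
    smul_eq_mul] using this

lemma exists_abs_cubic_remainder_le (N p q A : ℝ) : ∃ K : ℝ, 0 < K ∧ ∀ t b c i : ℝ,
    0 ≤ t → t ≤ 1 → |b| ≤ 1 → |c| ≤ 2 → 0 ≤ i → i ≤ A →
    |(N - 2 * t * b - t ^ 2) * (1 + p * ((2 * t * c + t ^ 2) * i)
        + q * ((2 * t * c + t ^ 2) * i) ^ 2)
      - (N + t * (-2 * b + 2 * N * p * c * i)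
        + t ^ 2 * (-1 + N * p * i - 4 * p * i * (b * c) + 4 * N * q * i ^ 2 * c ^ 2))| ≤
      K * t ^ 3 := by
  let F : ℝ × ℝ × ℝ × ℝ → ℝ := fun ⟨t, b, c, i⟩ ↦
    (4 * N * q * c * i ^ 2 - 2 * b * (p * i + 4 * q * c ^ 2 * i ^ 2) - 2 * p * c * i)
    + t * (N * q * i ^ 2 - 8 * q * b * c * i ^ 2 - p * i - 4 * q * c ^ 2 * i ^ 2)
    + t ^ 2 * (-2 * b * q * i ^ 2 - 4 * q * c * i ^ 2) - t ^ 3 * q * i ^ 2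
  have hF : Continuous F := by fun_prop
  obtain ⟨K, hK⟩ := (((isCompact_Icc (a := (0 : ℝ)) (b := 1)).prod
    ((isCompact_Icc (a := (-1 : ℝ)) (b := 1)).prod ((isCompact_Icc (a := (-2 : ℝ)) (b := 2)).prod
    (isCompact_Icc (a := (0 : ℝ)) (b := A)))))).exists_bound_of_continuousOn hF.continuousOn
  refine ⟨max K 1, by positivity, fun t b c i ht ht' hb hc hi hi' ↦ ?_⟩
  have h := hK (t, b, c, i) ⟨⟨ht, ht'⟩, abs_le.1 hb, abs_le.1 hc, hi, hi'⟩
  rw [Real.norm_eq_abs] at h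
  have h3 : 0 ≤ t ^ 3 := by positivity
  calc _ = |F (t, b, c, i) * t ^ 3| := by
        congr 1
        simp only [F]
        ring
    _ = |F (t, b, c, i)| * t ^ 3 := by rw [abs_mul, abs_of_nonneg h3]
    _ ≤ _ := by gcongr; exact h.trans (le_max_left _ _)

section PoissonKernel

variable {E : Type*} [NormedAddCommGroup E]

/-- The Poisson kernel of the unit ball of an `m`-dimensional Euclidean space, normalized so that
its mean over the unit sphere is `1`. -/
def ballPoissonKernel (m : ℕ) (x y : E) : ℝ := (1 - ‖x‖ ^ 2) / ‖x - y‖ ^ m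

lemma one_sub_norm_le_norm_sub {x y : E} (hy : ‖y‖ = 1) : 1 - ‖x‖ ≤ ‖x - y‖ := by
  have := norm_sub_norm_le y x
  rwa [hy, norm_sub_rev] at this

lemma continuousOn_ballPoissonKernel (m : ℕ) {y : E} (hy : ‖y‖ = 1) :
    ContinuousOn (fun x ↦ ballPoissonKernel m x y) (ball 0 1) := by
  unfold ballPoissonKernel
  refine ContinuousOn.div (by fun_prop) (by fun_prop) fun x hx ↦ ?_
  have h := one_sub_norm_le_norm_sub (x := x) hy
  rw [mem_ball_zero_iff] at hx
  have : 0 < ‖x - y‖ := by linarith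
  positivity

lemma ballPoissonKernel_nonneg (m : ℕ) {x : E} (hx : ‖x‖ ≤ 1) (y : E) :
    0 ≤ ballPoissonKernel m x y := by
  have : 0 ≤ 1 - ‖x‖ ^ 2 := by nlinarith [norm_nonneg x]
  unfold ballPoissonKernel
  positivity

lemma ballPoissonKernel_le (m : ℕ) {x y : E} (hx : ‖x‖ < 1) (hy : ‖y‖ = 1) :
    ballPoissonKernel m x y ≤ (1 - ‖x‖ ^ 2) / (1 - ‖x‖) ^ m := by
  have : 0 ≤ 1 - ‖x‖ ^ 2 := by nlinarith [norm_nonneg x]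
  have : 0 < 1 - ‖x‖ := by linarith
  unfold ballPoissonKernel
  gcongr
  exact one_sub_norm_le_norm_sub hy

lemma abs_ballPoissonKernel_le (m : ℕ) {x y : E} {r : ℝ} (hr : r < 1) (hx : ‖x‖ ≤ r)
    (hy : ‖y‖ = 1) : |ballPoissonKernel m x y| ≤ 1 / (1 - r) ^ m := by
  have hr' : 0 < 1 - r := by linarith
  rw [abs_of_nonneg (ballPoissonKernel_nonneg m (hx.trans hr.le) y)]
  refine (ballPoissonKernel_le m (hx.trans_lt hr) hy).trans ?_
  gcongr
  nlinarith [norm_nonneg x]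

lemma measurable_ballPoissonKernel [MeasurableSpace E] [BorelSpace E]
    [SecondCountableTopology E] (m : ℕ) :
    Measurable fun z : E × E ↦ ballPoissonKernel m z.1 z.2 := by
  unfold ballPoissonKernel
  fun_prop

lemma measurable_ballPoissonKernel_right [MeasurableSpace E] [BorelSpace E]
    [SecondCountableTopology E] (m : ℕ) (x : E) : Measurable (ballPoissonKernel m x) := by
  unfold ballPoissonKernel
  fun_prop

variable [InnerProductSpace ℝ E]

lemma norm_add_smul_lt_one {x ω : E} {t : ℝ} (ht : 0 < t) (htx : t < 1 - ‖x‖) (hω : ‖ω‖ = 1) :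
    ‖x + t • ω‖ < 1 := by
  have := norm_add_le x (t • ω)
  rw [norm_smul, hω, Real.norm_of_nonneg ht.le] at this
  linarith

lemma continuous_add_smul (x : E) (t : ℝ) : Continuous fun ω : E ↦ x + t • ω := by fun_prop

/-- The first order coefficient of the expansion of `t ↦ ballPoissonKernel m (x + t • ω) y`, up to
the factor `‖x - y‖ ^ m`. -/
def ballPoissonKernelCoeffOne (m : ℕ) (x y ω : E) : ℝ :=
  -2 * inner ℝ x ω + 2 * (1 - ‖x‖ ^ 2) * (-(m : ℝ) / 2) * inner ℝ (x - y) ω * (‖x - y‖ ^ 2)⁻¹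

/-- The second order coefficient of the expansion of `t ↦ ballPoissonKernel m (x + t • ω) y`, up to
the factor `‖x - y‖ ^ m`. -/
def ballPoissonKernelCoeffTwo (m : ℕ) (x y ω : E) : ℝ :=
  -1 + (1 - ‖x‖ ^ 2) * (-(m : ℝ) / 2) * (‖x - y‖ ^ 2)⁻¹
    - 4 * (-(m : ℝ) / 2) * (‖x - y‖ ^ 2)⁻¹ * (inner ℝ x ω * inner ℝ (x - y) ω)
    + 4 * (1 - ‖x‖ ^ 2) * ((-(m : ℝ) / 2) * (-(m : ℝ) / 2 - 1) / 2) * (‖x - y‖ ^ 2)⁻¹ ^ 2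
      * inner ℝ (x - y) ω ^ 2

lemma norm_add_smul_sq {x ω : E} (hω : ‖ω‖ = 1) (t : ℝ) :
    ‖x + t • ω‖ ^ 2 = ‖x‖ ^ 2 + 2 * t * inner ℝ x ω + t ^ 2 := by
  rw [norm_add_sq_real, inner_smul_right, norm_smul, hω, mul_one, Real.norm_eq_abs, sq_abs]
  ring

lemma abs_sub_two_mul_sub_sq_le {N t b : ℝ} (hN0 : 0 ≤ N) (hN1 : N ≤ 1) (ht0 : 0 ≤ t)
    (ht1 : t ≤ 1) (hb : |b| ≤ 1) : |N - 2 * t * b - t ^ 2| ≤ 4 := by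
  have h : |2 * t * b| ≤ 2 := by
    rw [abs_mul, abs_of_nonneg (by positivity)]
    nlinarith [abs_nonneg b]
  rw [abs_le] at h ⊢
  constructor <;> nlinarith

lemma exists_abs_ballPoissonKernel_sub_le (m : ℕ) {x : E} (hx : ‖x‖ < 1) :
    ∃ K t₀ : ℝ, 0 < K ∧ 0 < t₀ ∧ ∀ t, 0 < t → t < t₀ → ∀ y ω : E, ‖y‖ = 1 → ‖ω‖ = 1 →
      |ballPoissonKernel m (x + t • ω) y - ballPoissonKernel m x y
        - (t * ballPoissonKernelCoeffOne m x y ω + t ^ 2 * ballPoissonKernelCoeffTwo m x y ω)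
          / ‖x - y‖ ^ m| ≤ K * t ^ 3 := by
  set p : ℝ := -(m : ℝ) / 2 with hp
  set N : ℝ := 1 - ‖x‖ ^ 2 with hN
  have hd : 0 < 1 - ‖x‖ := by linarith
  set A : ℝ := ((1 - ‖x‖) ^ 2)⁻¹ with hA
  have hA0 : 0 < A := by positivity
  obtain ⟨C, η, hC, hη, htaylor⟩ := exists_abs_one_add_rpow_sub_le p
  obtain ⟨K, hK, hcubic⟩ := exists_abs_cubic_remainder_le N p (p * (p - 1) / 2) A
  refine ⟨(4 * (C * (5 * A) ^ 3) + K) / (1 - ‖x‖) ^ m, min 1 (η / (5 * A)), by positivity,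
    by positivity, fun t ht ht₀ y ω hy hω ↦ ?_⟩
  have ht1 : t ≤ 1 := (ht₀.trans_le (min_le_left _ _)).le
  have htη : 5 * A * t ≤ η := by
    have := (ht₀.trans_le (min_le_right _ _)).le
    rwa [le_div_iff₀ (by positivity), mul_comm] at this
  have hz1 : 1 - ‖x‖ ≤ ‖x - y‖ := one_sub_norm_le_norm_sub hy
  have hz2 : ‖x - y‖ ≤ 2 := (norm_sub_le x y).trans (by rw [hy]; linarith)
  have hz0 : 0 < ‖x - y‖ := hd.trans_le hz1
  have hkernel : ballPoissonKernel m (x + t • ω) y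
      = (N - 2 * t * inner ℝ x ω - t ^ 2) / ‖(x - y) + t • ω‖ ^ m := by
    rw [ballPoissonKernel, norm_add_smul_sq hω, add_sub_right_comm, hN]
    ring
  simp only [ballPoissonKernelCoeffOne, ballPoissonKernelCoeffTwo, ← hp, ← hN]
  rw [hkernel, ballPoissonKernel, ← hN]
  set b : ℝ := inner ℝ x ω
  set c : ℝ := inner ℝ (x - y) ω
  have hb : |b| ≤ 1 := (abs_real_inner_le_norm x ω).trans (by rw [hω]; linarith)
  have hc : |c| ≤ 2 := (abs_real_inner_le_norm (x - y) ω).trans (by rw [hω]; linarith)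
  set i : ℝ := (‖x - y‖ ^ 2)⁻¹ with hi
  have hi0 : 0 ≤ i := by positivity
  have hiA : i ≤ A := by rw [hi, hA]; gcongr
  set τ : ℝ := (2 * t * c + t ^ 2) * i with hτ
  have hτabs : |τ| ≤ 5 * A * t := by
    rw [hτ, abs_mul, abs_of_nonneg hi0]
    have : |2 * t * c + t ^ 2| ≤ 5 * t := by
      rw [abs_le] at hc ⊢
      constructor <;> nlinarith only [ht, ht1, hc.1, hc.2]
    calc _ ≤ 5 * t * A := by gcongr
      _ = _ := by ring
  have hsq : ‖(x - y) + t • ω‖ ^ 2 = ‖x - y‖ ^ 2 * (1 + τ) := by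
    rw [norm_add_smul_sq hω, hτ, hi]
    field_simp
    ring
  have hτ1 : 0 ≤ 1 + τ := by
    by_contra! h
    have : 0 ≤ ‖x - y‖ ^ 2 * (1 + τ) := hsq ▸ sq_nonneg _
    exact this.not_gt (mul_neg_of_pos_of_neg (by positivity) h)
  have hpow (w : E) : (‖w‖ ^ m)⁻¹ = (‖w‖ ^ 2) ^ p := by
    rw [← Real.rpow_natCast ‖w‖ 2, ← Real.rpow_mul (norm_nonneg _), hp,
      ← Real.rpow_natCast, ← Real.rpow_neg (norm_nonneg _)]
    congr 1
    push_cast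
    ring
  have hden : (‖(x - y) + t • ω‖ ^ m)⁻¹ = (‖x - y‖ ^ m)⁻¹ * (1 + τ) ^ p := by
    rw [hpow, hsq, Real.mul_rpow (by positivity) hτ1, ← hpow]
  have hrem := htaylor τ (hτabs.trans htη)
  have hcub := hcubic t b c i ht.le ht1 hb hc hi0 hiA
  rw [← hτ] at hcub
  set L := -2 * b + 2 * N * p * c * i
  set Q := -1 + N * p * i - 4 * p * i * (b * c) + 4 * N * (p * (p - 1) / 2) * i ^ 2 * c ^ 2
  set T := 1 + p * τ + p * (p - 1) / 2 * τ ^ 2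
  have hM : |N - 2 * t * b - t ^ 2| ≤ 4 :=
    abs_sub_two_mul_sub_sq_le (by rw [hN]; nlinarith only [norm_nonneg x, hx])
      (by rw [hN]; nlinarith only [norm_nonneg x]) ht.le ht1 hb
  calc _ = |((N - 2 * t * b - t ^ 2) * ((1 + τ) ^ p - T)
            + ((N - 2 * t * b - t ^ 2) * T - (N + t * L + t ^ 2 * Q)))| * (‖x - y‖ ^ m)⁻¹ := by
        rw [← abs_of_nonneg (a := (‖x - y‖ ^ m)⁻¹) (by positivity), ← abs_mul]
        congr 1
        rw [div_eq_mul_inv, hden]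
        ring
    _ ≤ (4 * (C * (5 * A * t) ^ 3) + K * t ^ 3) * ((1 - ‖x‖) ^ m)⁻¹ := by
        gcongr
        refine (abs_add_le _ _).trans (add_le_add ?_ hcub)
        rw [abs_mul]
        gcongr
        exact hrem.trans (by gcongr)
    _ = _ := by ring

end PoissonKernel

section InvariantSphereMeasure

variable {E : Type*} [NormedAddCommGroup E] [InnerProductSpace ℝ E]

lemma exists_linearIsometryEquiv_apply_eq {x x' : E} (h : ‖x‖ = ‖x'‖) :
    ∃ L : E ≃ₗᵢ[ℝ] E, L x = x' :=
  ⟨_, Submodule.reflection_sub h⟩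

variable [MeasurableSpace E]

/-- A rotation invariant probability measure on the unit sphere, regarded as a measure on the
ambient space. -/
structure IsInvariantSphereProb (σ : Measure E) : Prop where
  isProbabilityMeasure : IsProbabilityMeasure σ
  norm_eq_one : ∀ᵐ ω ∂σ, ‖ω‖ = 1
  map_eq : ∀ L : E ≃ₗᵢ[ℝ] E, σ.map L = σ

namespace IsInvariantSphereProb

variable {σ : Measure E} (hσ : IsInvariantSphereProb σ)

include hσ

lemma ae_of_norm_eq_one {p : E → Prop} (h : ∀ ω, ‖ω‖ = 1 → p ω) : ∀ᵐ ω ∂σ, p ω :=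
  hσ.norm_eq_one.mono h

lemma restrict_sphere : σ.restrict (sphere (0 : E) 1) = σ :=
  Measure.restrict_eq_self_of_ae_mem (hσ.ae_of_norm_eq_one fun _ h ↦ by simpa using h)

variable [BorelSpace E]

lemma integral_comp (L : E ≃ₗᵢ[ℝ] E) (f : E → ℝ) : ∫ ω, f (L ω) ∂σ = ∫ ω, f ω ∂σ := by
  conv_rhs => rw [← hσ.map_eq L]
  exact (integral_map_equiv L.toHomeomorph.toMeasurableEquiv f).symm

lemma integral_inner (x : E) : ∫ ω, inner ℝ x ω ∂σ = 0 := by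
  have := hσ.integral_comp (LinearIsometryEquiv.neg ℝ) (fun ω ↦ inner ℝ x ω)
  simp only [LinearIsometryEquiv.coe_neg, inner_neg_right, integral_neg] at this
  linarith

variable [FiniteDimensional ℝ E]

lemma integrable_of_continuousOn {f : E → ℝ} (hf : ContinuousOn f (sphere (0 : E) 1)) :
    Integrable f σ := by
  have := hσ.isProbabilityMeasure
  have := FiniteDimensional.proper_real E
  have h := hf.integrableOn_compact (μ := σ) (isCompact_sphere 0 1)
  rwa [IntegrableOn, hσ.restrict_sphere] at h

lemma integrable_of_continuous {f : E → ℝ} (hf : Continuous f) : Integrable f σ :=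
  hσ.integrable_of_continuousOn hf.continuousOn

lemma integral_inner_sq (z : E) :
    Module.finrank ℝ E * ∫ ω, inner ℝ z ω ^ 2 ∂σ = ‖z‖ ^ 2 := by
  have := hσ.isProbabilityMeasure
  let b := stdOrthonormalBasis ℝ E
  have h (i) : ∫ ω, inner ℝ z ω ^ 2 ∂σ = ‖z‖ ^ 2 * ∫ ω, inner ℝ (b i) ω ^ 2 ∂σ := by
    obtain ⟨L, hL⟩ := exists_linearIsometryEquiv_apply_eq (x := z) (x' := ‖z‖ • b i)
      (by simp [norm_smul])
    rw [← hσ.integral_comp L.symm, ← integral_const_mul]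
    congr 1 with ω
    rw [← L.inner_map_map, hL, L.apply_symm_apply, inner_smul_left]
    simp [mul_pow]
  have hsum : ∑ i, ∫ ω, inner ℝ (b i) ω ^ 2 ∂σ = 1 := by
    rw [← integral_finsetSum _ fun i _ ↦ hσ.integrable_of_continuous (by fun_prop)]
    rw [integral_congr_ae (g := fun _ ↦ (1 : ℝ)) (hσ.ae_of_norm_eq_one fun ω hω ↦ ?_)]
    · simp
    · simp [b.sum_sq_inner_right, hω]
  calc _ = ∑ _i : Fin (Module.finrank ℝ E), ∫ ω, inner ℝ z ω ^ 2 ∂σ := by simp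
    _ = ∑ i, ‖z‖ ^ 2 * ∫ ω, inner ℝ (b i) ω ^ 2 ∂σ := Finset.sum_congr rfl fun i _ ↦ h i
    _ = ‖z‖ ^ 2 := by rw [← Finset.mul_sum, hsum, mul_one]

lemma integral_inner_mul_inner (x z : E) :
    Module.finrank ℝ E * ∫ ω, inner ℝ x ω * inner ℝ z ω ∂σ = inner ℝ x z := by
  have h (ω : E) : inner ℝ x ω * inner ℝ z ω
      = (inner ℝ (x + z) ω ^ 2 - inner ℝ (x - z) ω ^ 2) / 4 := by
    rw [inner_add_left, inner_sub_left]
    ring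
  simp_rw [h]
  rw [integral_div, integral_sub (hσ.integrable_of_continuous (by fun_prop))
    (hσ.integrable_of_continuous (by fun_prop)), mul_div_assoc', mul_sub, hσ.integral_inner_sq,
    hσ.integral_inner_sq, norm_add_sq_real, norm_sub_sq_real]
  ring

lemma integral_norm_add_smul_sq (x : E) (t : ℝ) :
    ∫ ω, ‖x + t • ω‖ ^ 2 ∂σ = ‖x‖ ^ 2 + t ^ 2 := by
  have := hσ.isProbabilityMeasure
  rw [integral_congr_ae (hσ.ae_of_norm_eq_one fun ω hω ↦ norm_add_smul_sq hω t),
    integral_add (hσ.integrable_of_continuous (by fun_prop)) (integrable_const _),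
    integral_add (integrable_const _) (hσ.integrable_of_continuous (by fun_prop)),
    integral_const_mul, hσ.integral_inner]
  simp

lemma integral_ballPoissonKernelCoeffOne (m : ℕ) (x y : E) :
    ∫ ω, ballPoissonKernelCoeffOne m x y ω ∂σ = 0 := by
  simp only [ballPoissonKernelCoeffOne]
  rw [integral_add (hσ.integrable_of_continuous (by fun_prop))
    (hσ.integrable_of_continuous (by fun_prop)), integral_mul_const, integral_const_mul,
    integral_const_mul, hσ.integral_inner, hσ.integral_inner]
  simp

lemma integral_ballPoissonKernelCoeffTwo {x y : E} (hy : ‖y‖ = 1) (hxy : x ≠ y) :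
    ∫ ω, ballPoissonKernelCoeffTwo (Module.finrank ℝ E) x y ω ∂σ = 0 := by
  have := hσ.isProbabilityMeasure
  have hz : ‖x - y‖ ^ 2 ≠ 0 := by simpa [sub_eq_zero] using hxy
  have hm : (Module.finrank ℝ E : ℝ) ≠ 0 := by
    have : Nontrivial E := ⟨x, y, hxy⟩
    exact_mod_cast Module.finrank_pos.ne'
  have h1 := hσ.integral_inner_mul_inner x (x - y)
  have h2 := hσ.integral_inner_sq (x - y)
  simp only [ballPoissonKernelCoeffTwo]
  rw [integral_add (hσ.integrable_of_continuous (by fun_prop))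
    (hσ.integrable_of_continuous (by fun_prop)),
    integral_sub (integrable_const _) (hσ.integrable_of_continuous (by fun_prop)),
    integral_const_mul, integral_const_mul]
  simp only [integral_const, probReal_univ, one_smul]
  set m : ℝ := ((Module.finrank ℝ E : ℕ) : ℝ)
  rw [eq_div_of_mul_eq hm ((mul_comm _ _).trans h1), eq_div_of_mul_eq hm ((mul_comm _ _).trans h2)]
  have h3 : ‖x - y‖ ^ 2 = ‖x‖ ^ 2 - 2 * inner ℝ x y + 1 := by rw [norm_sub_sq_real, hy]; ring
  have h4 : inner ℝ x (x - y) = ‖x‖ ^ 2 - inner ℝ x y := by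
    rw [inner_sub_right, real_inner_self_eq_norm_sq]
  have h5 : inner ℝ x y = (‖x‖ ^ 2 + 1 - ‖x - y‖ ^ 2) / 2 := by linarith
  rw [h4, h5]
  generalize ‖x - y‖ ^ 2 = a at hz
  field_simp
  ring

lemma exists_abs_integral_ballPoissonKernel_sub_le {x : E} (hx : ‖x‖ < 1) :
    ∃ K t₀ : ℝ, 0 < K ∧ 0 < t₀ ∧ ∀ t, 0 < t → t < t₀ → ∀ y : E, ‖y‖ = 1 →
      |∫ ω, ballPoissonKernel (Module.finrank ℝ E) (x + t • ω) y ∂σ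
        - ballPoissonKernel (Module.finrank ℝ E) x y| ≤ K * t ^ 3 := by
  have := hσ.isProbabilityMeasure
  set m := Module.finrank ℝ E with hm
  obtain ⟨K, t₀, hK, ht₀, h⟩ := exists_abs_ballPoissonKernel_sub_le m hx
  refine ⟨K, min t₀ (1 - ‖x‖), hK, lt_min ht₀ (by linarith), fun t ht htt y hy ↦ ?_⟩
  have htx : t < 1 - ‖x‖ := htt.trans_le (min_le_right _ _)
  have hxy : x ≠ y := by rintro rfl; linarith
  have hint : Integrable (fun ω ↦ ballPoissonKernel m (x + t • ω) y) σ := by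
    refine hσ.integrable_of_continuousOn ((continuousOn_ballPoissonKernel m hy).comp
      (continuous_add_smul x t).continuousOn fun ω hω ↦ ?_)
    rw [mem_ball_zero_iff]
    exact norm_add_smul_lt_one ht htx (by simpa using hω)
  have hint1 : Integrable (ballPoissonKernelCoeffOne m x y) σ :=
    hσ.integrable_of_continuous (by unfold ballPoissonKernelCoeffOne; fun_prop)
  have hint2 : Integrable (ballPoissonKernelCoeffTwo m x y) σ :=
    hσ.integrable_of_continuous (by unfold ballPoissonKernelCoeffTwo; fun_prop)
  have hint3 : Integrable (fun ω ↦ t * ballPoissonKernelCoeffOne m x y ω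
      + t ^ 2 * ballPoissonKernelCoeffTwo m x y ω) σ := (hint1.const_mul _).add (hint2.const_mul _)
  have hint4 : Integrable (fun ω ↦ ballPoissonKernel m (x + t • ω) y - ballPoissonKernel m x y) σ :=
    hint.sub (integrable_const _)
  have key : ∫ ω, (ballPoissonKernel m (x + t • ω) y - ballPoissonKernel m x y
        - (t * ballPoissonKernelCoeffOne m x y ω + t ^ 2 * ballPoissonKernelCoeffTwo m x y ω)
          / ‖x - y‖ ^ m) ∂σ
      = ∫ ω, ballPoissonKernel m (x + t • ω) y ∂σ - ballPoissonKernel m x y := by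
    rw [integral_sub hint4 (hint3.div_const _),
      integral_sub hint (integrable_const _), integral_div,
      integral_add (hint1.const_mul _) (hint2.const_mul _), integral_const_mul,
      integral_const_mul, hσ.integral_ballPoissonKernelCoeffOne,
      hσ.integral_ballPoissonKernelCoeffTwo hy hxy]
    simp
  rw [← key, ← Real.norm_eq_abs]
  refine (norm_integral_le_of_norm_le_const (C := K * t ^ 3)
    (hσ.ae_of_norm_eq_one fun ω hω ↦ ?_)).trans_eq
    (by simp)
  exact h t ht (htt.trans_le (min_le_left _ _)) y ω hy hω

variable {f : E → ℝ} {M : ℝ}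

lemma integrable_ballPoissonKernel_mul (m : ℕ) (hf : Continuous f) (hM : ∀ y, |f y| ≤ M)
    {x : E} (hx : ‖x‖ < 1) : Integrable (fun y ↦ ballPoissonKernel m x y * f y) σ := by
  have := hσ.isProbabilityMeasure
  have := FiniteDimensional.proper_real E
  refine Integrable.of_bound (C := 1 / (1 - ‖x‖) ^ m * M) ?_
    (hσ.ae_of_norm_eq_one fun y hy ↦ ?_)
  · exact ((measurable_ballPoissonKernel_right m x).mul hf.measurable).aestronglyMeasurable
  · rw [norm_mul]
    have h := abs_ballPoissonKernel_le m hx le_rfl hy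
    exact mul_le_mul h (hM y) (norm_nonneg _) ((abs_nonneg _).trans h)

lemma continuousOn_poissonIntegral (m : ℕ) (hf : Continuous f) (hM : ∀ y, |f y| ≤ M)
    {r : ℝ} (hr : r < 1) :
    ContinuousOn (fun x ↦ ∫ y, ballPoissonKernel m x y * f y ∂σ) (closedBall 0 r) := by
  have := hσ.isProbabilityMeasure
  have := FiniteDimensional.proper_real E
  refine continuousOn_of_dominated (bound := fun _ ↦ 1 / (1 - r) ^ m * M) (fun x _ ↦ ?_)
    (fun x hx ↦ hσ.ae_of_norm_eq_one fun y hy ↦ ?_) (integrable_const _)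
    (hσ.ae_of_norm_eq_one fun y hy ↦ ?_)
  · exact ((measurable_ballPoissonKernel_right m x).mul hf.measurable).aestronglyMeasurable
  · rw [norm_mul]
    have h := abs_ballPoissonKernel_le m hr (by simpa using hx) hy
    exact mul_le_mul h (hM y) (norm_nonneg _) ((abs_nonneg _).trans h)
  · exact ((continuousOn_ballPoissonKernel m hy).mono (closedBall_subset_ball hr)).mul
      continuousOn_const

lemma exists_abs_integral_poissonIntegral_sub_le (hf : Continuous f) (hM : ∀ y, |f y| ≤ M)
    {x : E} (hx : ‖x‖ < 1) :
    ∃ K t₀ : ℝ, 0 < K ∧ 0 < t₀ ∧ ∀ t, 0 < t → t < t₀ →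
      |∫ ω, ∫ y, ballPoissonKernel (Module.finrank ℝ E) (x + t • ω) y * f y ∂σ ∂σ
        - ∫ y, ballPoissonKernel (Module.finrank ℝ E) x y * f y ∂σ| ≤ K * t ^ 3 := by
  have := hσ.isProbabilityMeasure
  have := FiniteDimensional.proper_real E
  set m := Module.finrank ℝ E with hm
  obtain ⟨K, t₀, hK, ht₀, h⟩ := hσ.exists_abs_integral_ballPoissonKernel_sub_le hx
  have hM0 : 0 ≤ M := (abs_nonneg _).trans (hM 0)
  refine ⟨K * (M + 1), min t₀ (1 - ‖x‖), by positivity, lt_min ht₀ (by linarith),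
    fun t ht htt ↦ ?_⟩
  have htx : t < 1 - ‖x‖ := htt.trans_le (min_le_right _ _)
  have hr : ‖x‖ + t < 1 := by linarith
  have hint : Integrable (Function.uncurry fun ω y ↦ ballPoissonKernel m (x + t • ω) y * f y)
      (σ.prod σ) := by
    refine Integrable.of_bound (C := 1 / (1 - (‖x‖ + t)) ^ m * M) ?_ ?_
    · refine Measurable.aestronglyMeasurable (f := Function.uncurry fun ω y ↦
        ballPoissonKernel m (x + t • ω) y * f y) ?_
      have h1 : Measurable fun z : E × E ↦ (x + t • z.1, z.2) := by fun_prop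
      exact ((measurable_ballPoissonKernel m).comp h1).mul (hf.measurable.comp measurable_snd)
    · filter_upwards [Measure.quasiMeasurePreserving_fst.ae hσ.norm_eq_one,
        Measure.quasiMeasurePreserving_snd.ae hσ.norm_eq_one] with z hz1 hz2
      rw [Function.uncurry, norm_mul]
      have h := abs_ballPoissonKernel_le m hr (x := x + t • z.1) (y := z.2)
        ((norm_add_le _ _).trans (by simp [norm_smul, hz1, abs_of_pos ht])) hz2
      exact mul_le_mul h (hM _) (norm_nonneg _) ((abs_nonneg _).trans h)
  rw [integral_integral_swap hint]
  have hint1 : Integrable (fun y ↦ ∫ ω, ballPoissonKernel m (x + t • ω) y * f y ∂σ) σ :=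
    hint.integral_prod_right
  have hint2 := hσ.integrable_ballPoissonKernel_mul m hf hM hx
  rw [← integral_sub hint1 hint2, ← Real.norm_eq_abs]
  refine (norm_integral_le_of_norm_le_const (C := K * t ^ 3 * M)
    (hσ.ae_of_norm_eq_one fun y hy ↦ ?_)).trans ?_
  · rw [integral_mul_const, ← sub_mul, norm_mul]
    exact mul_le_mul (h t ht (htt.trans_le (min_le_left _ _)) y hy) (hM y) (norm_nonneg _)
      (by positivity)
  · have : 0 ≤ K * t ^ 3 := by positivity
    simp only [probReal_univ, mul_one]
    nlinarith

variable (σ) in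
/-- A function satisfying, at `x`, the sub-mean inequality over small spheres up to an error which
is negligible with respect to the square of the radius. -/
def IsAsymptoticallySubmeanAt (u : E → ℝ) (x : E) : Prop :=
  ∀ ε > 0, ∃ t₀ > 0, ∀ t, 0 < t → t < t₀ → u x ≤ ∫ ω, u (x + t • ω) ∂σ + ε * t ^ 2

lemma le_of_isAsymptoticallySubmeanAt {u : E → ℝ} {r C : ℝ}
    (hu : ContinuousOn u (closedBall 0 r))
    (hsub : ∀ x : E, ‖x‖ < r → IsAsymptoticallySubmeanAt σ u x)
    (hC : ∀ x : E, ‖x‖ = r → u x ≤ C) {x : E} (hx : ‖x‖ ≤ r) : u x ≤ C := by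
  have := hσ.isProbabilityMeasure
  have := FiniteDimensional.proper_real E
  suffices h : ∀ δ > 0, u x ≤ C + δ * r ^ 2 by
    refine le_of_forall_pos_le_add fun ε hε ↦ (h (ε / (r ^ 2 + 1)) (by positivity)).trans ?_
    gcongr
    rw [div_mul_eq_mul_div, div_le_iff₀ (by positivity)]
    nlinarith
  intro δ hδ
  have hcont : ContinuousOn (fun y ↦ u y + δ * ‖y‖ ^ 2) (closedBall 0 r) :=
    hu.add (by fun_prop)
  obtain ⟨z, hz, hmax⟩ := (isCompact_closedBall (0 : E) r).exists_isMaxOn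
    ⟨x, by simpa using hx⟩ hcont
  rw [mem_closedBall_zero_iff] at hz
  rcases hz.lt_or_eq with hzr | hzr
  · exfalso
    obtain ⟨t₀, ht₀, ht⟩ := hsub z hzr (δ / 2) (by positivity)
    obtain ⟨t, htpos, htlt⟩ := exists_between (lt_min ht₀ (sub_pos.2 hzr))
    have hmem {ω : E} (hω : ‖ω‖ = 1) : z + t • ω ∈ closedBall (0 : E) r := by
      rw [mem_closedBall_zero_iff]
      refine (norm_add_le _ _).trans ?_
      rw [norm_smul, hω, Real.norm_of_nonneg htpos.le]
      linarith [htlt.le.trans (min_le_right _ _)]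
    have hint : Integrable (fun ω ↦ u (z + t • ω)) σ :=
      hσ.integrable_of_continuousOn (hu.comp (continuous_add_smul z t).continuousOn
        fun ω hω ↦ hmem (by simpa using hω))
    have hint' : Integrable (fun ω ↦ δ * ‖z + t • ω‖ ^ 2) σ :=
      hσ.integrable_of_continuous (by fun_prop)
    have h1 : ∫ ω, (u (z + t • ω) + δ * ‖z + t • ω‖ ^ 2) ∂σ
        ≤ ∫ _ω, (u z + δ * ‖z‖ ^ 2) ∂σ :=
      integral_mono_ae (hint.add hint') (integrable_const _)
        (hσ.ae_of_norm_eq_one fun ω hω ↦ hmax (hmem hω))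
    rw [integral_add hint hint', integral_const_mul, hσ.integral_norm_add_smul_sq,
      integral_const, probReal_univ, one_smul] at h1
    have h2 := ht t htpos (htlt.trans_le (min_le_left _ _))
    have : 0 < δ * t ^ 2 := by positivity
    linarith
  · have h1 : u x + δ * ‖x‖ ^ 2 ≤ u z + δ * ‖z‖ ^ 2 := hmax (by simpa using hx)
    have h2 := hC z hzr
    have : 0 ≤ δ * ‖x‖ ^ 2 := by positivity
    rw [hzr] at h1
    linarith

lemma isAsymptoticallySubmeanAt_sub_poissonIntegral {w : E → ℝ} (hw : Continuous w)
    (hsub : ∀ (x : E) (t : ℝ), 0 < t → ‖x‖ + t < 1 → w x ≤ ∫ ω, w (x + t • ω) ∂σ)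
    (hf : Continuous f) (hM : ∀ y, |f y| ≤ M) {x : E} (hx : ‖x‖ < 1) :
    IsAsymptoticallySubmeanAt σ
      (fun x ↦ w x - ∫ y, ballPoissonKernel (Module.finrank ℝ E) x y * f y ∂σ) x := by
  intro ε hε
  obtain ⟨K, t₀, hK, ht₀, h⟩ := hσ.exists_abs_integral_poissonIntegral_sub_le hf hM hx
  refine ⟨min t₀ (min (1 - ‖x‖) (ε / K)), lt_min ht₀ (lt_min (by linarith) (by positivity)),
    fun t ht htt ↦ ?_⟩
  have htx : ‖x‖ + t < 1 := by
    linarith [htt.trans_le ((min_le_right _ _).trans (min_le_left _ _))]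
  have htK : t * K ≤ ε := by
    rw [← le_div_iff₀ hK]
    exact (htt.trans_le ((min_le_right _ _).trans (min_le_right _ _))).le
  have hint : Integrable (fun ω ↦ ∫ y, ballPoissonKernel (Module.finrank ℝ E) (x + t • ω) y * f y
      ∂σ) σ := by
    refine hσ.integrable_of_continuousOn
      ((hσ.continuousOn_poissonIntegral (Module.finrank ℝ E) hf hM htx).comp
        (continuous_add_smul x t).continuousOn fun ω hω ↦ ?_)
    rw [mem_closedBall_zero_iff]
    refine (norm_add_le _ _).trans_eq ?_
    rw [norm_smul, Real.norm_of_nonneg ht.le, mem_sphere_zero_iff_norm.1 hω, mul_one]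
  rw [integral_sub (hσ.integrable_of_continuous (by fun_prop)) hint]
  have h1 := hsub x t ht htx
  have h2 := (abs_le.1 (h t ht (htt.trans_le (min_le_left _ _)))).2
  have h3 : K * t ^ 3 ≤ ε * t ^ 2 := by
    calc K * t ^ 3 = (t * K) * t ^ 2 := by ring
      _ ≤ _ := by gcongr
  linarith

lemma integral_ballPoissonKernel {x : E} (hx : ‖x‖ < 1) :
    ∫ y, ballPoissonKernel (Module.finrank ℝ E) x y ∂σ = 1 := by
  have := hσ.isProbabilityMeasure
  have hrad {x' : E} (h : ‖x'‖ = ‖x‖) : ∫ y, ballPoissonKernel (Module.finrank ℝ E) x' y ∂σ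
      = ∫ y, ballPoissonKernel (Module.finrank ℝ E) x y ∂σ := by
    obtain ⟨L, rfl⟩ := exists_linearIsometryEquiv_apply_eq h
    rw [← hσ.integral_comp L (ballPoissonKernel _ (L x'))]
    simp only [ballPoissonKernel, ← map_sub, L.norm_map]
  have hzero : ∫ y, ballPoissonKernel (Module.finrank ℝ E) (0 : E) y ∂σ = 1 := by
    rw [integral_congr_ae (g := fun _ ↦ (1 : ℝ)) (hσ.ae_of_norm_eq_one fun y hy ↦ ?_)]
    · simp
    · simp [ballPoissonKernel, hy]
  have hle (c : ℝ) : c * ∫ y, ballPoissonKernel (Module.finrank ℝ E) x y ∂σ ≤ c := by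
    have hmax := hσ.le_of_isAsymptoticallySubmeanAt (r := ‖x‖) (x := 0)
      (u := fun x ↦ 0 - ∫ y, ballPoissonKernel (Module.finrank ℝ E) x y * c ∂σ)
      (C := -(c * ∫ y, ballPoissonKernel (Module.finrank ℝ E) x y ∂σ))
      (continuousOn_const.sub (hσ.continuousOn_poissonIntegral _ continuous_const
        (fun _ ↦ le_rfl) hx))
      (fun z hz ↦ hσ.isAsymptoticallySubmeanAt_sub_poissonIntegral continuous_const (by simp)
        continuous_const (fun _ ↦ le_rfl) (hz.trans hx))
      (fun z hz ↦ by rw [integral_mul_const, hrad hz]; linarith)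
      (by simp)
    rw [integral_mul_const, hzero] at hmax
    linarith
  linarith [hle 1, hle (-1)]

variable {v : E → ℝ}

lemma exists_sub_poissonIntegral_le (hv : Continuous v) (hv0 : ∀ y, 0 ≤ v y)
    (hvM : ∀ y, v y ≤ M) {ε : ℝ} (hε : 0 < ε) :
    ∃ ρ < 1, ∀ x : E, ρ ≤ ‖x‖ → ‖x‖ < 1 →
      v x - ∫ y, ballPoissonKernel (Module.finrank ℝ E) x y * v y ∂σ ≤ ε := by
  have := hσ.isProbabilityMeasure
  have := FiniteDimensional.proper_real E
  set m := Module.finrank ℝ E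
  have hM0 : 0 ≤ M := (hv0 0).trans (hvM 0)
  obtain ⟨δ, hδ, hunif⟩ := Metric.uniformContinuousOn_iff.1
    ((isCompact_closedBall (0 : E) 1).uniformContinuousOn_of_continuous hv.continuousOn) (ε / 2)
    (by positivity)
  have hη : 0 < ε * δ ^ m / (4 * (M + 1)) := by positivity
  refine ⟨1 - ε * δ ^ m / (4 * (M + 1)), by linarith, fun x hρ hx ↦ ?_⟩
  have hN : 0 ≤ 1 - ‖x‖ ^ 2 := by nlinarith [norm_nonneg x]
  have hfar : (1 - ‖x‖ ^ 2) / δ ^ m * M ≤ ε / 2 := by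
    have h1 : 1 - ‖x‖ ≤ ε * δ ^ m / (4 * (M + 1)) := by linarith
    rw [le_div_iff₀ (by positivity)] at h1
    rw [div_mul_eq_mul_div, div_le_iff₀ (by positivity)]
    nlinarith [norm_nonneg x, mul_nonneg hM0 hN]
  have hint1 : Integrable (ballPoissonKernel m x) σ := by
    simpa using hσ.integrable_ballPoissonKernel_mul m continuous_const
      (fun _ ↦ le_refl |(1 : ℝ)|) hx
  have hint2 : Integrable (fun y ↦ ballPoissonKernel m x y * v y) σ :=
    hσ.integrable_ballPoissonKernel_mul m hv
      (fun y ↦ (abs_of_nonneg (hv0 y)).trans_le (hvM y)) hx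
  have hone := hσ.integral_ballPoissonKernel hx
  have hle : ∫ y, (ballPoissonKernel m x y * v x - ballPoissonKernel m x y * v y) ∂σ
      ≤ ∫ y, (ballPoissonKernel m x y * (ε / 2) + ε / 2) ∂σ := by
    refine integral_mono_ae ((hint1.mul_const _).sub hint2)
      ((hint1.mul_const _).add (integrable_const _)) (hσ.ae_of_norm_eq_one fun y hy ↦ ?_)
    have hP := ballPoissonKernel_nonneg m hx.le y
    change ballPoissonKernel m x y * v x - ballPoissonKernel m x y * v y
      ≤ ballPoissonKernel m x y * (ε / 2) + ε / 2
    rcases lt_or_ge ‖x - y‖ δ with hxy | hxy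
    · have h := hunif x (by simpa using hx.le) y (by simp [hy]) (by rwa [dist_eq_norm])
      rw [Real.dist_eq, abs_lt] at h
      nlinarith [mul_le_mul_of_nonneg_left h.2.le hP]
    · have h1 : ballPoissonKernel m x y ≤ (1 - ‖x‖ ^ 2) / δ ^ m := by
        unfold ballPoissonKernel
        gcongr
      have h2 := mul_le_mul_of_nonneg_right h1 hM0
      have h3 := mul_le_mul_of_nonneg_left (hvM x) hP
      have h4 := mul_nonneg hP (hv0 y)
      have h5 : 0 ≤ ballPoissonKernel m x y * (ε / 2) := by positivity
      linarith
  rw [integral_sub (hint1.mul_const _) hint2, integral_add (hint1.mul_const _) (integrable_const _),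
    integral_mul_const, integral_mul_const, hone] at hle
  simp only [integral_const, probReal_univ, one_smul, one_mul] at hle
  linarith

lemma le_poissonIntegral (hv : Continuous v) (hv0 : ∀ y, 0 ≤ v y) (hvM : ∀ y, v y ≤ M)
    (hsub : ∀ (x : E) (t : ℝ), 0 < t → ‖x‖ + t < 1 → v x ≤ ∫ ω, v (x + t • ω) ∂σ)
    {x : E} (hx : ‖x‖ < 1) :
    v x ≤ ∫ y, ballPoissonKernel (Module.finrank ℝ E) x y * v y ∂σ := by
  have hM (y : E) : |v y| ≤ M := (abs_of_nonneg (hv0 y)).trans_le (hvM y)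
  refine le_of_forall_pos_le_add fun ε hε ↦ ?_
  obtain ⟨ρ, hρ, hbdry⟩ := hσ.exists_sub_poissonIntegral_le hv hv0 hvM hε
  have hr : max ρ ‖x‖ < 1 := max_lt hρ hx
  have := hσ.le_of_isAsymptoticallySubmeanAt (r := max ρ ‖x‖) (C := ε)
    (hv.continuousOn.sub (hσ.continuousOn_poissonIntegral (Module.finrank ℝ E) hv hM hr))
    (fun z hz ↦ hσ.isAsymptoticallySubmeanAt_sub_poissonIntegral hv hsub hv hM (hz.trans hr))
    (fun z hz ↦ hbdry z (hz ▸ le_max_left _ _) (hz ▸ hr)) (le_max_right _ _)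
  simp only [Pi.sub_apply] at this
  linarith

/-- **Harnack-type bound** on the unit ball for nonnegative functions satisfying the sub-mean
inequality. -/
theorem le_mul_integral_of_submean [Nontrivial E] (hv : Continuous v) (hv0 : ∀ y, 0 ≤ v y)
    (hvM : ∀ y, v y ≤ M)
    (hsub : ∀ (x : E) (t : ℝ), 0 < t → ‖x‖ + t < 1 → v x ≤ ∫ ω, v (x + t • ω) ∂σ)
    {x : E} (hx : ‖x‖ < 1) :
    v x ≤ (1 + ‖x‖) / (1 - ‖x‖) ^ (Module.finrank ℝ E - 1) * ∫ ω, v ω ∂σ := by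
  refine (hσ.le_poissonIntegral hv hv0 hvM hsub hx).trans ?_
  rw [← integral_const_mul]
  refine integral_mono_ae (hσ.integrable_ballPoissonKernel_mul _ hv
    (fun y ↦ (abs_of_nonneg (hv0 y)).trans_le (hvM y)) hx)
    (hσ.integrable_of_continuous (by fun_prop)) (hσ.ae_of_norm_eq_one fun y hy ↦ ?_)
  refine mul_le_mul_of_nonneg_right ((ballPoissonKernel_le _ hx hy).trans_eq ?_) (hv0 y)
  have h1 : 1 - ‖x‖ ≠ 0 := by linarith
  rw [← Nat.sub_one_add_one (Module.finrank_pos (R := ℝ) (M := E)).ne', pow_succ,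
    Nat.add_sub_cancel]
  field_simp
  ring

end IsInvariantSphereProb

end InvariantSphereMeasure

section HausdorffSphere

variable {E : Type*} [NormedAddCommGroup E] [MeasurableSpace E] [BorelSpace E]

lemma map_add_smul_hausdorffMeasure [NormedSpace ℝ E] {d : ℝ} (hd : 0 ≤ d) (x : E) {t : ℝ}
    (ht : t ≠ 0) :
    Measure.map (fun ω ↦ x + t • ω) (μH[d] : Measure E) = ‖t‖₊⁻¹ ^ d • μH[d] := by
  have h : (fun ω : E ↦ x + t • ω) = IsometryEquiv.addLeft x ∘ AffineMap.homothety (0 : E) t := by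
    ext ω
    simp [AffineMap.homothety_apply]
  rw [h, ← Measure.map_map (IsometryEquiv.addLeft x).continuous.measurable
    (AffineMap.homothety_continuous (0 : E) t).measurable,
    map_homothety_hausdorffMeasure hd _ ht, Measure.map_smul, IsometryEquiv.map_hausdorffMeasure]

omit [MeasurableSpace E] [BorelSpace E] in
lemma preimage_add_smul_sphere [NormedSpace ℝ E] (x : E) {t : ℝ} (ht : 0 < t) :
    (fun ω ↦ x + t • ω) ⁻¹' sphere x t = sphere 0 1 := by
  ext ω
  simp [norm_smul, abs_of_pos ht, ht.ne']

lemma hausdorffMeasure_sphere_ne_top [NormedSpace ℝ E] {d : ℝ} (hd : 0 ≤ d)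
    (h : μH[d] (sphere (0 : E) 1) ≠ ⊤) (x : E) {t : ℝ} (ht : 0 < t) : μH[d] (sphere x t) ≠ ⊤ := by
  have hmap := DFunLike.congr_fun (map_add_smul_hausdorffMeasure hd x ht.ne') (sphere x t)
  rw [Measure.map_apply (by fun_prop) isClosed_sphere.measurableSet,
    preimage_add_smul_sphere x ht] at hmap
  intro htop
  refine h (hmap.trans ?_)
  rw [Measure.smul_apply, htop, ENNReal.smul_top, if_neg]
  simp [NNReal.rpow_eq_zero_iff, ht.ne']

lemma setIntegral_sphere_hausdorffMeasure [NormedSpace ℝ E] {d : ℝ} (hd : 0 ≤ d) (v : E → ℝ)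
    (x : E) {t : ℝ} (ht : 0 < t) :
    ∫ y in sphere x t, v y ∂μH[d] = t ^ d * ∫ ω in sphere 0 1, v (x + t • ω) ∂μH[d] := by
  have h := setIntegral_map_equiv (μ := (μH[d] : Measure E))
    ((Homeomorph.smulOfNeZero t ht.ne').trans (Homeomorph.addLeft x)).toMeasurableEquiv v
    (sphere x t)
  change ∫ y in sphere x t, v y ∂(Measure.map (fun ω ↦ x + t • ω) μH[d])
    = ∫ ω in (fun ω ↦ x + t • ω) ⁻¹' sphere x t, v (x + t • ω) ∂μH[d] at h
  rw [map_add_smul_hausdorffMeasure hd x ht.ne', preimage_add_smul_sphere x ht,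
    Measure.restrict_smul, integral_smul_nnreal_measure, NNReal.smul_def, smul_eq_mul] at h
  rw [← h, ← mul_assoc, NNReal.coe_rpow, NNReal.coe_inv, coe_nnnorm, Real.norm_of_nonneg ht.le,
    Real.inv_rpow ht.le, mul_inv_cancel₀ (by positivity), one_mul]

lemma isInvariantSphereProb_hausdorffMeasure [InnerProductSpace ℝ E] {d : ℝ}
    (h0 : μH[d] (sphere (0 : E) 1) ≠ 0) (htop : μH[d] (sphere (0 : E) 1) ≠ ⊤) :
    IsInvariantSphereProb
      ((μH[d] (sphere (0 : E) 1))⁻¹ • (μH[d] : Measure E).restrict (sphere (0 : E) 1)) where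
  isProbabilityMeasure := ⟨by simp [ENNReal.inv_mul_cancel h0 htop]⟩
  norm_eq_one := Measure.ae_smul_measure
    ((ae_restrict_mem isClosed_sphere.measurableSet).mono fun ω hω ↦ by simpa using hω) _
  map_eq L := by
    have h := Measure.restrict_map (μ := (μH[d] : Measure E)) (f := L) L.continuous.measurable
      (isClosed_sphere (x := (0 : E)) (ε := 1)).measurableSet
    have hmap : Measure.map L (μH[d] : Measure E) = μH[d] :=
      L.toIsometryEquiv.map_hausdorffMeasure d
    have hpre : L ⁻¹' sphere (0 : E) 1 = sphere 0 1 := by ext; simp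
    rw [hmap, hpre] at h
    rw [Measure.map_smul, ← h]

end HausdorffSphere

lemma eIntegral_coe_of_nonneg {α : Type*} [MeasurableSpace α] {μ : Measure α} {f : α → ℝ}
    (hf : Integrable f μ) (h0 : 0 ≤ᵐ[μ] f) :
    eIntegral μ (fun x ↦ (f x : EReal)) = (∫ x, f x ∂μ : ℝ) := by
  have hpos : ∫⁻ x, (f x : EReal).toENNReal' ∂μ = ENNReal.ofReal (∫ x, f x ∂μ) := by
    rw [ofReal_integral_eq_lintegral_ofReal hf h0]
    simp [EReal.toENNReal']
  have hneg : ∫⁻ x, (-(f x : EReal)).toENNReal' ∂μ = 0 := by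
    refine (lintegral_congr_ae (h0.mono fun x hx ↦ ?_)).trans lintegral_zero
    rw [EReal.toENNReal', ← EReal.coe_neg, if_neg (EReal.coe_ne_top _), EReal.toReal_coe]
    exact ENNReal.ofReal_of_nonpos (neg_nonpos.2 hx)
  rw [eIntegral, hpos, hneg, EReal.coe_ennreal_ofReal, max_eq_left (integral_nonneg_of_ae h0)]
  simp

section SphereMean

variable {m : ℕ}

/-- The normalized surface measure on the unit sphere of `ℝᵐ`. -/
def unitSphereProb (m : ℕ) : Measure (Em m) :=
  (μH[(m : ℝ) - 1] (sphere (0 : Em m) 1))⁻¹ •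
    (μH[(m : ℝ) - 1] : Measure (Em m)).restrict (sphere (0 : Em m) 1)

lemma isInvariantSphereProb_unitSphereProb (h : sphereArea m ≠ 0) :
    IsInvariantSphereProb (unitSphereProb m) :=
  isInvariantSphereProb_hausdorffMeasure (fun h0 ↦ h (by simp [sphereArea, h0]))
    (fun h0 ↦ h (by simp [sphereArea, h0]))

lemma rSMean_eq_integral (hm : 1 ≤ m) (v : Em m → ℝ) (x : Em m) {t : ℝ} (ht : 0 < t) :
    rSMean m v x t = ∫ ω, v (x + t • ω) ∂unitSphereProb m := by
  have hd : ((m - 1 : ℕ) : ℝ) = (m : ℝ) - 1 := by push_cast [hm]; rfl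
  rw [rSMean, setIntegral_sphere_hausdorffMeasure (hd ▸ Nat.cast_nonneg _) v x ht, unitSphereProb,
    integral_smul_measure, ← hd, Real.rpow_natCast, smul_eq_mul, ENNReal.toReal_inv, hd,
    ← sphereArea, one_div, mul_inv, mul_assoc, inv_mul_cancel_left₀ (by positivity)]

lemma sMean_coe (hm : 1 ≤ m) (h : sphereArea m ≠ 0) {v : Em m → ℝ} {x : Em m} {t : ℝ}
    (ht : 0 < t) (hv : ContinuousOn v (sphere x t)) (hv0 : ∀ y ∈ sphere x t, 0 ≤ v y) :
    sMean m (fun y ↦ (v y : EReal)) x t = (rSMean m v x t : ℝ) := by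
  have hd : ((m - 1 : ℕ) : ℝ) = (m : ℝ) - 1 := by push_cast [hm]; rfl
  have hfin : μH[(m : ℝ) - 1] (sphere x t) ≠ ⊤ :=
    hausdorffMeasure_sphere_ne_top (hd ▸ Nat.cast_nonneg _)
      (fun h0 ↦ h (by simp [sphereArea, h0])) x ht
  have hint : IntegrableOn v (sphere x t) μH[(m : ℝ) - 1] :=
    hv.integrableOn_of_subset_isCompact (isCompact_sphere x t) isClosed_sphere.measurableSet
      Subset.rfl hfin
  rw [sMean, sphereMeasure, eIntegral_coe_of_nonneg hint
    ((ae_restrict_mem isClosed_sphere.measurableSet).mono hv0), rSMean, EReal.coe_mul]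

end SphereMean

/-- Harnack-type bound: a continuous nonnegative function on `B̄(0,R) ⊂ ℝᵐ`, subharmonic
on the open ball, satisfies
`v(x') ≤ ((R + |x'|) R^{m−2} / (R − |x'|)^{m−1}) 𝐒_v(0,R)` for all `x' ∈ B(0,R)`. -/
theorem harnack_type_bound (m : ℕ) (hm : 1 ≤ m) (R : ℝ) (hR : 0 < R)
    (v : Em m → ℝ)
    (hcont : ContinuousOn v (Metric.closedBall (0 : Em m) R))
    (hpos : ∀ x ∈ Metric.closedBall (0 : Em m) R, 0 ≤ v x)
    (hsub : SubharmonicOn m (fun x => ((v x : ℝ) : EReal)) (Metric.ball (0 : Em m) R)) :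
    ∀ x' ∈ Metric.ball (0 : Em m) R,
      v x' ≤ (R + ‖x'‖) * R ^ ((m : ℝ) - 2) / (R - ‖x'‖) ^ ((m : ℝ) - 1) * rSMean m v 0 R := by
  intro x' hx'
  rw [mem_ball_zero_iff] at hx'
  by_cases hA : sphereArea m = 0
  · obtain ⟨t, ht, htR⟩ := exists_between (sub_pos.2 hx')
    have h := hsub.2.2 x' (by simpa using hx') t ht
      (closedBall_subset_ball' (by rw [dist_zero_right]; linarith))
    simp only [sMean, hA, zero_mul, div_zero, EReal.coe_zero] at h
    simpa [rSMean, hA] using h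
  have hσ := isInvariantSphereProb_unitSphereProb hA
  have hsubmean (x : Em m) (t : ℝ) (ht : 0 < t) (hxt : ‖x‖ + t < R) :
      v x ≤ ∫ ω, v (x + t • ω) ∂unitSphereProb m := by
    have hball : closedBall x t ⊆ ball 0 R :=
      closedBall_subset_ball' (by rw [dist_zero_right]; linarith)
    have hsph := (sphere_subset_closedBall.trans hball).trans ball_subset_closedBall
    have h := hsub.2.2 x (hball (mem_closedBall_self ht.le)) t ht hball
    rw [sMean_coe hm hA ht (hcont.mono hsph) fun y hy ↦ hpos y (hsph hy)] at h
    exact (EReal.coe_le_coe_iff.1 h).trans_eq (rSMean_eq_integral hm v x ht)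
  have hr (y : Em m) : (R / max 1 ‖y‖) • y ∈ closedBall (0 : Em m) R := by
    have hy : 0 < max 1 ‖y‖ := by positivity
    rw [mem_closedBall_zero_iff, norm_smul, Real.norm_of_nonneg (by positivity),
      div_mul_eq_mul_div, div_le_iff₀ hy]
    gcongr
    exact le_max_right _ _
  have hr1 {y : Em m} (hy : ‖y‖ ≤ 1) : (R / max 1 ‖y‖) • y = R • y := by
    rw [max_eq_left hy, div_one]
  obtain ⟨M, hM⟩ := (isCompact_closedBall (0 : Em m) R).exists_bound_of_continuousOn hcont
  have hnt : Nontrivial (Em m) :=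
    Module.nontrivial_of_finrank_pos (R := ℝ) (by rw [finrank_euclideanSpace_fin]; omega)
  have hx1 : ‖R⁻¹ • x'‖ = ‖x'‖ / R := by
    rw [norm_smul, norm_inv, Real.norm_of_nonneg hR.le, inv_mul_eq_div]
  have hlt : ‖x'‖ / R < 1 := (div_lt_one hR).2 hx'
  have key := hσ.le_mul_integral_of_submean (v := fun y ↦ v ((R / max 1 ‖y‖) • y)) (M := M)
    (hcont.comp_continuous (Continuous.smul (continuous_const.div
      (continuous_const.max continuous_norm) fun y ↦ (lt_max_of_lt_left one_pos).ne')
      continuous_id) hr)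
    (fun y ↦ hpos _ (hr y)) (fun y ↦ (le_abs_self _).trans (hM _ (hr y)))
    (fun x t ht hxt ↦ ?_) (hx1 ▸ hlt : ‖R⁻¹ • x'‖ < 1)
  · rw [hr1 (hx1 ▸ hlt.le), smul_inv_smul₀ hR.ne', hx1, finrank_euclideanSpace_fin,
      integral_congr_ae (g := fun ω ↦ v (0 + R • ω))
        (hσ.ae_of_norm_eq_one fun ω hω ↦ by simp only [hr1 hω.le, zero_add]),
      ← rSMean_eq_integral hm v 0 hR] at key
    refine key.trans_eq (congrArg (· * rSMean m v 0 R) ?_)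
    have hd : (m : ℝ) - 1 = (m - 1 : ℕ) := by push_cast [hm]; rfl
    have hRx : R - ‖x'‖ ≠ 0 := by linarith
    rw [show (m : ℝ) - 2 = (m - 1 : ℕ) - 1 by rw [← hd]; ring, hd, Real.rpow_sub_one hR.ne',
      Real.rpow_natCast, Real.rpow_natCast, one_sub_div hR.ne', div_pow]
    field_simp
  · have hmem {ω : Em m} (hω : ‖ω‖ = 1) : ‖x + t • ω‖ ≤ 1 := by
      refine (norm_add_le _ _).trans ?_
      rw [norm_smul, hω, Real.norm_of_nonneg ht.le]
      linarith
    rw [hr1 (by linarith), integral_congr_ae (g := fun ω ↦ v (R • x + (R * t) • ω))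
      (hσ.ae_of_norm_eq_one fun ω hω ↦ by simp only [hr1 (hmem hω), smul_add, mul_smul])]
    refine hsubmean _ _ (by positivity) ?_
    rw [norm_smul, Real.norm_of_nonneg hR.le, ← mul_add]
    exact mul_lt_of_lt_one_right hR hxt
end
end

section
/- Let S : (0, +∞) → [0, +∞) be an increasing function of finite order, i.e. limsup_{r→+∞} ln(1 + S(r))/ln r < +∞. Let (r_k)_{k∈ℕ} be an unbounded increasing sequence of positive real numbers, let Q > 1, and let (ε_k)_{k∈ℕ} be positive numbers with lim_{k→∞} ε_k = 0 such that r_{k+1} ≤ Q r_k and S(r_k) ≤ ε_k · S(Q r_k) for every k ∈ ℕ. Then S is identically zero on (0, +∞). -/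
open Filter Set
open scoped Topology

noncomputable section

/-- A function of finite order is dominated by some power of its argument. -/
theorem eventually_le_pow_of_limsup_log_div_log_lt_top {S : ℝ → ℝ}
    (hpos : ∀ t : ℝ, 0 < t → 0 ≤ S t)
    (hord : Filter.limsup
      (fun t : ℝ => ((Real.log (1 + S t) / Real.log t : ℝ) : EReal)) atTop < ⊤) :
    ∃ p : ℕ, ∀ᶠ t in atTop, S t ≤ t ^ p := by
  obtain ⟨M, hM, -⟩ := EReal.lt_iff_exists_real_btwn.1 hord
  obtain ⟨p, hp⟩ := exists_nat_ge M
  refine ⟨p, ?_⟩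
  filter_upwards [eventually_lt_of_limsup_lt hM, eventually_gt_atTop 1] with t ht ht1
  have hlog : 0 < Real.log t := Real.log_pos ht1
  have hlt : Real.log (1 + S t) / Real.log t < M := by exact_mod_cast ht
  have hle : Real.log (1 + S t) ≤ Real.log (t ^ p) := by
    rw [Real.log_pow]
    exact (div_le_iff₀ hlog).1 (hlt.le.trans hp)
  have hS := hpos t (by linarith)
  have := (Real.log_le_log_iff (by linarith) (by positivity)).1 hle
  linarith

/-- Smallness relative to the dilation by `Q` along a commensurable unbounded sequence yields
smallness relative to the dilation by `Q * Q` at every large point. -/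
theorem eventually_le_mul_dilation {S : ℝ → ℝ}
    (hmono : ∀ s t : ℝ, 0 < s → s ≤ t → S s ≤ S t)
    (hpos : ∀ t : ℝ, 0 < t → 0 ≤ S t)
    {r : ℕ → ℝ} (hrpos : ∀ k, 0 < r k) (hrmono : Monotone r)
    (hrunb : Tendsto r atTop atTop)
    {Q : ℝ} (hQ : 1 < Q)
    {ε : ℕ → ℝ} (hε0 : Tendsto ε atTop (𝓝 0))
    (hQr : ∀ k, r (k + 1) ≤ Q * r k)
    (hSε : ∀ k, S (r k) ≤ ε k * S (Q * r k)) {c : ℝ} (hc : 0 < c) :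
    ∀ᶠ t in atTop, S t ≤ c * S (Q * Q * t) := by
  obtain ⟨K, hK⟩ := eventually_atTop.1 (hε0.eventually_le_const hc)
  filter_upwards [eventually_ge_atTop (r K)] with t ht
  have ht0 : 0 < t := (hrpos K).trans_le ht
  have hex : ∃ j, t < r j := (hrunb.eventually_gt_atTop t).exists
  classical
  have hj := Nat.find_spec hex
  have hmin : ∀ m < Nat.find hex, ¬ t < r m := fun m => Nat.find_min hex
  generalize Nat.find hex = j at hj hmin
  have hKj : K < j := by
    by_contra! h
    exact absurd (hrmono h) (by linarith)
  obtain ⟨m, rfl⟩ : ∃ m, j = m + 1 := ⟨j - 1, by omega⟩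
  have hm : r m ≤ t := not_lt.1 (hmin m (by omega))
  have hQ0 : 0 < Q := by linarith
  have hr : r (m + 1) ≤ Q * t := (hQr m).trans (by gcongr)
  have hQrpos : 0 < Q * r (m + 1) := mul_pos hQ0 (hrpos _)
  calc S t ≤ S (r (m + 1)) := hmono _ _ ht0 hj.le
    _ ≤ ε (m + 1) * S (Q * r (m + 1)) := hSε _
    _ ≤ c * S (Q * r (m + 1)) :=
      mul_le_mul_of_nonneg_right (hK _ hKj.le) (hpos _ hQrpos)
    _ ≤ c * S (Q * Q * t) := by
      refine mul_le_mul_of_nonneg_left (hmono _ _ hQrpos ?_) hc.le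
      rw [mul_assoc]
      gcongr

/-- A function dominated by `t ^ p` that satisfies `S t ≤ c * S (A * t)` for large `t`, with
`c * A ^ p < 1`, is eventually nonpositive. -/
theorem eventually_nonpos_of_le_mul_dilation {S : ℝ → ℝ} {A c : ℝ} {p : ℕ}
    (hA : 1 < A) (hc : 0 < c) (hcA : c * A ^ p < 1)
    (hpow : ∀ᶠ t in atTop, S t ≤ t ^ p) (hdil : ∀ᶠ t in atTop, S t ≤ c * S (A * t)) :
    ∀ᶠ t in atTop, S t ≤ 0 := by
  obtain ⟨T, hT⟩ := eventually_atTop.1 (hpow.and hdil)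
  filter_upwards [eventually_ge_atTop T, eventually_gt_atTop 0] with t ht ht0
  have hle : ∀ n : ℕ, t ≤ A ^ n * t := fun n =>
    le_mul_of_one_le_left ht0.le (one_le_pow₀ hA.le)
  have hiter : ∀ n : ℕ, S t ≤ c ^ n * S (A ^ n * t) := by
    intro n
    induction n with
    | zero => simp
    | succ n ih =>
      have h := mul_le_mul_of_nonneg_left (hT _ (ht.trans (hle n))).2 (pow_pos hc n).le
      calc S t ≤ c ^ n * S (A ^ n * t) := ih
        _ ≤ c ^ n * (c * S (A * (A ^ n * t))) := h
        _ = c ^ (n + 1) * S (A ^ (n + 1) * t) := by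
          rw [← mul_assoc, ← mul_assoc, ← pow_succ, ← pow_succ']
  have hbound : ∀ n : ℕ, S t ≤ (c * A ^ p) ^ n * t ^ p := by
    intro n
    calc S t ≤ c ^ n * S (A ^ n * t) := hiter n
      _ ≤ c ^ n * (A ^ n * t) ^ p :=
        mul_le_mul_of_nonneg_left (hT _ (ht.trans (hle n))).1 (pow_pos hc n).le
      _ = (c * A ^ p) ^ n * t ^ p := by ring
  have hlim : Tendsto (fun n : ℕ => (c * A ^ p) ^ n * t ^ p) atTop (𝓝 0) := by
    have hcA0 : 0 ≤ c * A ^ p := mul_nonneg hc.le (pow_nonneg (by linarith) p)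
    simpa using (tendsto_pow_atTop_nhds_zero_of_lt_one hcA0 hcA).mul_const (t ^ p)
  exact ge_of_tendsto' hlim hbound

/-- An increasing nonnegative function of finite order on `(0, +∞)` that is infinitely
small relative to itself along a commensurable unbounded sequence of points is
identically zero on `(0, +∞)`. -/
theorem increasing_finite_order_vanishes (S : ℝ → ℝ)
    (hmono : ∀ s t : ℝ, 0 < s → s ≤ t → S s ≤ S t)
    (hpos : ∀ t : ℝ, 0 < t → 0 ≤ S t)
    (hord : Filter.limsup
      (fun t : ℝ => ((Real.log (1 + S t) / Real.log t : ℝ) : EReal)) atTop < ⊤)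
    (r : ℕ → ℝ) (hrpos : ∀ k, 0 < r k) (hrmono : Monotone r)
    (hrunb : Tendsto r atTop atTop)
    (Q : ℝ) (hQ : 1 < Q)
    (ε : ℕ → ℝ) (hε : ∀ k, 0 < ε k) (hε0 : Tendsto ε atTop (𝓝 0))
    (hQr : ∀ k, r (k + 1) ≤ Q * r k)
    (hSε : ∀ k, S (r k) ≤ ε k * S (Q * r k)) :
    ∀ t : ℝ, 0 < t → S t = 0 := by
  obtain ⟨p, hp⟩ := eventually_le_pow_of_limsup_log_div_log_lt_top hpos hord
  have hA : 1 < Q * Q := by nlinarith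
  have hAp : 0 < (Q * Q) ^ p := by positivity
  have hc : 0 < ((Q * Q) ^ p)⁻¹ / 2 := by positivity
  have hcA : ((Q * Q) ^ p)⁻¹ / 2 * (Q * Q) ^ p < 1 := by
    rw [div_mul_eq_mul_div, inv_mul_cancel₀ hAp.ne']
    norm_num
  have hdil := eventually_le_mul_dilation hmono hpos hrpos hrmono hrunb hQ hε0 hQr hSε hc
  intro t ht
  obtain ⟨s, hs, hts⟩ :=
    ((eventually_nonpos_of_le_mul_dilation hA hc hcA hp hdil).and
      (eventually_ge_atTop t)).exists
  exact le_antisymm ((hmono t s ht hts).trans hs) (hpos t ht)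
end
end

section
/- Let m ∈ ℕ, 0 ≤ r₀ < r₁, let v be a subharmonic function on ℝᵐ \ B̄(0, r₀), and set M₀ := sup_{B̄(0,r₁) \ B̄(0,r₀)} v, assumed finite. Then the function w : ℝᵐ → ℝ defined by w(x) = M₀ for x ∈ B̄(0, r₁) and w(x) = max{v(x), M₀} for x ∈ ℝᵐ \ B̄(0, r₁) is subharmonic on all of ℝᵐ. Moreover, if v has finite order then so does w. -/
open MeasureTheory Metric Filter Set
open scoped ENNReal NNReal Topology Classical

noncomputable section

theorem hausdorffMeasure_isBounded_lt_top {n : ℕ} {s : Set (Fin n → ℝ)}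
    (hs : Bornology.IsBounded s) : μH[(n : ℝ)] s < ∞ := by
  have h : (μH[(n : ℝ)] : Measure (Fin n → ℝ)) = volume := by
    simpa using hausdorffMeasure_pi_real (ι := Fin n)
  rw [h]
  exact hs.measure_lt_top

/-- The sphere has positive measure because it projects onto a ball of one dimension less. -/
theorem hausdorffMeasure_sphere_pos (n : ℕ) :
    0 < μH[(n : ℝ)] (sphere (0 : EuclideanSpace ℝ (Fin (n + 1))) 1) := by
  have h : (μH[(n : ℝ)] : Measure (Fin n → ℝ)) = volume := by
    simpa using hausdorffMeasure_pi_real (ι := Fin n)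
  let p : EuclideanSpace ℝ (Fin (n + 1)) → (Fin n → ℝ) := fun x i => x i.succ
  have hp : LipschitzWith 1 p := LipschitzWith.of_dist_le_mul fun x y => by
    rw [NNReal.coe_one, one_mul, dist_pi_le_iff dist_nonneg]
    intro i
    rw [dist_eq_norm, dist_eq_norm]
    exact PiLp.norm_apply_le (x - y) i.succ
  have hsub : {y : Fin n → ℝ | ∑ i, y i ^ 2 < 1} ⊆
      p '' sphere (0 : EuclideanSpace ℝ (Fin (n + 1))) 1 := by
    intro y hy
    refine ⟨WithLp.toLp 2 (Fin.cons (√(1 - ∑ i, y i ^ 2)) y), ?_, ?_⟩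
    · rw [mem_sphere_zero_iff_norm, EuclideanSpace.norm_eq, Fin.sum_univ_succ]
      have : 0 ≤ 1 - ∑ i, y i ^ 2 := sub_nonneg.mpr (le_of_lt hy)
      simp [Real.sq_sqrt this]
    · ext i
      simp [p]
  have hpos : 0 < volume {y : Fin n → ℝ | ∑ i, y i ^ 2 < 1} :=
    IsOpen.measure_pos _ (isOpen_lt (by fun_prop) continuous_const) ⟨0, by simp⟩
  calc 0 < volume {y : Fin n → ℝ | ∑ i, y i ^ 2 < 1} := hpos
    _ = μH[(n : ℝ)] {y : Fin n → ℝ | ∑ i, y i ^ 2 < 1} := by rw [h]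
    _ ≤ μH[(n : ℝ)] (p '' sphere (0 : EuclideanSpace ℝ (Fin (n + 1))) 1) := measure_mono hsub
    _ ≤ _ := by simpa using hp.hausdorffMeasure_image_le n.cast_nonneg (sphere 0 1)

/-- The sphere is covered by the radial projections of the faces of a cube. -/
theorem hausdorffMeasure_sphere_lt_top (n : ℕ) :
    μH[(n : ℝ)] (sphere (0 : EuclideanSpace ℝ (Fin (n + 1))) 1) < ∞ := by
  let q : Fin (n + 1) → ℝ → (Fin n → ℝ) → EuclideanSpace ℝ (Fin (n + 1)) :=
    fun i s y => WithLp.toLp 2 (i.insertNth s y)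
  let F : Fin (n + 1) → ℝ → (Fin n → ℝ) → EuclideanSpace ℝ (Fin (n + 1)) :=
    fun i s y => ‖q i s y‖⁻¹ • q i s y
  have hq : ∀ i s, ContDiff ℝ 1 (q i s) := fun i s => by
    rw [contDiff_euclidean]
    intro j
    rcases Fin.eq_self_or_eq_succAbove i j with rfl | ⟨k, rfl⟩
    · simpa [q] using contDiff_const
    · simpa [q] using contDiff_apply ℝ ℝ k
  have hq0 : ∀ i s, s ≠ 0 → ∀ y, q i s y ≠ 0 := fun i s hs y h0 => by
    have := congrArg (fun z : EuclideanSpace ℝ (Fin (n + 1)) => z i) h0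
    simp [q] at this
    exact hs this
  have hF : ∀ i s, s ≠ 0 → ContDiff ℝ 1 (F i s) := fun i s hs =>
    (((hq i s).norm ℝ (hq0 i s hs)).inv fun y => norm_ne_zero_iff.mpr (hq0 i s hs y)).smul (hq i s)
  have hfin : ∀ i s, s ≠ 0 → μH[(n : ℝ)] (F i s '' closedBall 0 1) < ∞ := fun i s hs => by
    obtain ⟨K, hK⟩ := (hF i s hs).contDiffOn.exists_lipschitzOnWith one_ne_zero
      (convex_closedBall (0 : Fin n → ℝ) 1) (isCompact_closedBall 0 1)
    refine (hK.hausdorffMeasure_image_le n.cast_nonneg).trans_lt ?_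
    exact ENNReal.mul_lt_top (by simp)
      (hausdorffMeasure_isBounded_lt_top isBounded_closedBall)
  have hcov : sphere (0 : EuclideanSpace ℝ (Fin (n + 1))) 1 ⊆
      ⋃ i, (F i 1 '' closedBall 0 1 ∪ F i (-1) '' closedBall 0 1) := by
    intro ω hω
    rw [mem_sphere_zero_iff_norm] at hω
    obtain ⟨i, hi⟩ := Finite.exists_max fun i => |ω i|
    have hi0 : ω i ≠ 0 := fun h0 => by
      have : ω = 0 := by
        ext j
        have := hi j
        simp only [h0, abs_zero] at this
        simpa using abs_nonpos_iff.mp this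
      simp [this] at hω
    have hpos : 0 < |ω i| := abs_pos.mpr hi0
    have key : ∀ s : ℝ, s = ω i / |ω i| → ω ∈ F i s '' closedBall 0 1 := fun s hs => by
      refine ⟨fun k => ω (i.succAbove k) / |ω i|, ?_, ?_⟩
      · rw [mem_closedBall_zero_iff, pi_norm_le_iff_of_nonneg zero_le_one]
        intro k
        rw [Real.norm_eq_abs, abs_div, abs_abs, div_le_one hpos]
        exact hi _
      · have hqe : q i s (fun k => ω (i.succAbove k) / |ω i|) = |ω i|⁻¹ • ω := by
          ext j
          rcases Fin.eq_self_or_eq_succAbove i j with rfl | ⟨k, rfl⟩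
          · simp [q, hs, div_eq_inv_mul]
          · simp [q, div_eq_inv_mul]
        simp only [F, hqe, norm_smul, hω, smul_smul]
        simp [hpos.ne']
    refine mem_iUnion.mpr ⟨i, ?_⟩
    rcases hi0.lt_or_gt with h | h
    · exact Or.inr (key (-1) (by rw [abs_of_neg h, div_neg, div_self hi0]))
    · exact Or.inl (key 1 (by rw [abs_of_pos h, div_self hi0]))
  refine (measure_mono hcov).trans_lt ((measure_iUnion_le _).trans_lt ?_)
  rw [tsum_fintype]
  exact ENNReal.sum_lt_top.mpr fun i _ => (measure_union_le _ _).trans_lt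
    (ENNReal.add_lt_top.mpr ⟨hfin i 1 one_ne_zero, hfin i (-1) (by norm_num)⟩)

section UnitSphere

variable {m : ℕ}

theorem sphereMeasure_unit_univ_pos (hm : 1 ≤ m) : 0 < sphereMeasure m 0 1 univ := by
  obtain ⟨n, rfl⟩ := Nat.exists_eq_add_of_le' hm
  simpa [sphereMeasure] using hausdorffMeasure_sphere_pos n

theorem isFiniteMeasure_sphereMeasure_unit (hm : 1 ≤ m) :
    IsFiniteMeasure (sphereMeasure m 0 1) := by
  obtain ⟨n, rfl⟩ := Nat.exists_eq_add_of_le' hm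
  exact ⟨by simpa [sphereMeasure] using hausdorffMeasure_sphere_lt_top n⟩

theorem sphereMeasure_unit_map (e : Em m ≃ₗᵢ[ℝ] Em m) :
    (sphereMeasure m 0 1).map e = sphereMeasure m 0 1 := by
  have h1 : sphere (0 : Em m) 1 = e ⁻¹' sphere 0 1 := by ext; simp
  unfold sphereMeasure
  conv_lhs => rw [h1]
  rw [← Measure.restrict_map e.continuous.measurable isClosed_sphere.measurableSet]
  congr 1
  exact e.toIsometryEquiv.map_hausdorffMeasure _

theorem lintegral_sphereMeasure (hm : 1 ≤ m) (x : Em m) {t : ℝ} (ht : 0 < t)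
    {f : Em m → ℝ≥0∞} (hf : Measurable f) :
    ∫⁻ y, f y ∂sphereMeasure m x t =
      ENNReal.ofReal (t ^ (m - 1)) * ∫⁻ ω, f (x + t • ω) ∂sphereMeasure m 0 1 := by
  obtain ⟨n, rfl⟩ := Nat.exists_eq_add_of_le' hm
  have hmap : (sphereMeasure (n + 1) 0 1).map (fun ω => x + t • ω) =
      ENNReal.ofReal (t ^ n)⁻¹ • sphereMeasure (n + 1) x t := by
    have hc : Measurable fun ω : Em (n + 1) => x + t • ω := by fun_prop
    have h1 : sphere (0 : Em (n + 1)) 1 = (fun ω => x + t • ω) ⁻¹' sphere x t := by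
      ext ω
      simp [norm_smul, abs_of_pos ht, ht.ne']
    unfold sphereMeasure
    conv_lhs => rw [h1]
    rw [← Measure.restrict_map hc isClosed_sphere.measurableSet, ← Measure.restrict_smul]
    congr 1
    have h2 : (fun ω : Em (n + 1) => x + t • ω) =
        (IsometryEquiv.addLeft x) ∘ (AffineMap.homothety (0 : Em (n + 1)) t) := by
      ext ω
      simp [AffineMap.homothety_apply]
    rw [h2, ← Measure.map_map (by fun_prop) (by fun_prop),
      map_homothety_hausdorffMeasure (by simp) _ ht.ne', Measure.map_smul,
      IsometryEquiv.map_hausdorffMeasure]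
    ext s hs
    have h3 : (t ^ n)⁻¹ = (((‖t‖₊ ^ n)⁻¹ : ℝ≥0) : ℝ) := by simp [abs_of_pos ht]
    rw [h3, ENNReal.ofReal_coe_nnreal]
    simp
  have hc : Measurable fun ω : Em (n + 1) => x + t • ω := by fun_prop
  rw [← lintegral_map hf hc, hmap, lintegral_smul_measure, smul_eq_mul, ← mul_assoc,
    Nat.add_sub_cancel, ← ENNReal.ofReal_mul (by positivity), mul_inv_cancel₀ (by positivity)]
  simp

end UnitSphere

theorem toENNReal'_coe (r : ℝ) : (r : EReal).toENNReal' = ENNReal.ofReal r := by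
  simp [EReal.toENNReal']

theorem toENNReal'_add_le {x : EReal} {M : ℝ} {φ : ℝ≥0∞} (h : x ≤ M + φ) :
    x.toENNReal' + ENNReal.ofReal (-M) ≤ φ + (ENNReal.ofReal M + (-x).toENNReal') := by
  induction φ with
  | top => simp
  | coe p =>
    induction x with
    | bot => simp [EReal.toENNReal']
    | top => exact absurd h (not_le.mpr (EReal.coe_lt_top (M + p)))
    | coe r =>
      have hr : r ≤ M + p := EReal.coe_le_coe_iff.mp h
      rw [← EReal.coe_neg, toENNReal'_coe, toENNReal'_coe]
      simp only [ENNReal.ofReal, ← ENNReal.coe_add, ENNReal.coe_le_coe, ← NNReal.coe_le_coe,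
        NNReal.coe_add, Real.coe_toNNReal']
      linarith [max_zero_sub_eq_self M, max_zero_sub_eq_self r]

theorem le_toENNReal'_add {x : EReal} {M : ℝ} {φ : ℝ≥0∞} (h : (M : EReal) + φ = x) :
    φ + (ENNReal.ofReal M + (-x).toENNReal') ≤ x.toENNReal' + ENNReal.ofReal (-M) := by
  subst h
  induction φ with
  | top => simp [EReal.toENNReal']
  | coe p =>
    rw [show (M : EReal) + ((p : ℝ≥0∞) : EReal) = ((M + p : ℝ) : EReal) from rfl,
      ← EReal.coe_neg, toENNReal'_coe, toENNReal'_coe]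
    simp only [ENNReal.ofReal, ← ENNReal.coe_add, ENNReal.coe_le_coe, ← NNReal.coe_le_coe,
      NNReal.coe_add, Real.coe_toNNReal']
    linarith [max_zero_sub_eq_self M, max_zero_sub_eq_self (M + p)]

theorem eIntegral_of_ne_top {α : Type*} [MeasurableSpace α] {μ : Measure α} {g : α → EReal}
    (hP : ∫⁻ x, (g x).toENNReal' ∂μ ≠ ∞) (hN : ∫⁻ x, (-(g x)).toENNReal' ∂μ ≠ ∞) :
    eIntegral μ g = (((∫⁻ x, (g x).toENNReal' ∂μ).toReal -
      (∫⁻ x, (-(g x)).toENNReal' ∂μ).toReal : ℝ) : EReal) := by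
  rw [eIntegral, EReal.coe_sub, EReal.coe_ennreal_toReal hP, EReal.coe_ennreal_toReal hN]

section Mean

variable {α : Type*} [MeasurableSpace α] {μ : Measure α} [IsFiniteMeasure μ]

theorem ofReal_sub_mul_le_lintegral (hμ : μ ≠ 0) {g : α → EReal} {f : α → ℝ≥0∞}
    (hf : Measurable f) {a M : ℝ} (hg : ∀ᵐ y ∂μ, g y ≤ M + f y)
    (ha : (a : EReal) ≤ ((1 / (μ univ).toReal : ℝ) : EReal) * eIntegral μ g) :
    ENNReal.ofReal (a - M) * μ univ ≤ ∫⁻ y, f y ∂μ := by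
  have hS := measure_ne_top μ univ
  have hSpos : 0 < (μ univ).toReal := ENNReal.toReal_pos (by simpa using hμ) hS
  by_cases hF : ∫⁻ y, f y ∂μ = ∞
  · simp [hF]
  have key : ∫⁻ y, (g y).toENNReal' ∂μ + ENNReal.ofReal (-M) * μ univ ≤
      ∫⁻ y, f y ∂μ + (ENNReal.ofReal M * μ univ + ∫⁻ y, (-(g y)).toENNReal' ∂μ) := by
    rw [← lintegral_const, ← lintegral_const, ← lintegral_add_right _ measurable_const,
      ← lintegral_add_left measurable_const, ← lintegral_add_left hf]
    exact lintegral_mono_ae (hg.mono fun y hy => toENNReal'_add_le hy)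
  have hN : ∫⁻ y, (-(g y)).toENNReal' ∂μ ≠ ∞ := fun hN => by
    rw [eIntegral, hN, EReal.coe_ennreal_top, EReal.sub_top,
      EReal.coe_mul_bot_of_pos (by positivity)] at ha
    exact EReal.coe_ne_bot a (le_bot_iff.mp ha)
  have hM := ENNReal.mul_ne_top (ENNReal.ofReal_ne_top (r := M)) hS
  have hM' := ENNReal.mul_ne_top (ENNReal.ofReal_ne_top (r := -M)) hS
  have hR := ENNReal.add_ne_top.mpr ⟨hF, ENNReal.add_ne_top.mpr ⟨hM, hN⟩⟩
  have hP : ∫⁻ y, (g y).toENNReal' ∂μ ≠ ∞ := ne_top_of_le_ne_top hR (le_self_add.trans key)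
  have key' := ENNReal.toReal_mono hR key
  rw [ENNReal.toReal_add hP hM', ENNReal.toReal_add hF (ENNReal.add_ne_top.mpr ⟨hM, hN⟩),
    ENNReal.toReal_add hM hN, ENNReal.toReal_mul, ENNReal.toReal_mul, ENNReal.toReal_ofReal',
    ENNReal.toReal_ofReal'] at key'
  rw [eIntegral_of_ne_top hP hN, ← EReal.coe_mul, EReal.coe_le_coe_iff, one_div,
    inv_mul_eq_div, le_div_iff₀ hSpos] at ha
  rw [← ENNReal.ofReal_toReal hS, ← ENNReal.ofReal_mul' hSpos.le, ← ENNReal.ofReal_toReal hF]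
  refine ENNReal.ofReal_le_ofReal ?_
  have hmax := max_zero_sub_eq_self M
  nlinarith

theorem le_mul_eIntegral (hμ : μ ≠ 0) {g : α → EReal} {f : α → ℝ≥0∞}
    (hf : Measurable f) {a M : ℝ} (hg : ∀ y, (M : EReal) + f y = g y)
    (ha : ENNReal.ofReal (a - M) * μ univ ≤ ∫⁻ y, f y ∂μ) :
    (a : EReal) ≤ ((1 / (μ univ).toReal : ℝ) : EReal) * eIntegral μ g := by
  have hS := measure_ne_top μ univ
  have hSpos : 0 < (μ univ).toReal := ENNReal.toReal_pos (by simpa using hμ) hS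
  have key : ∫⁻ y, f y ∂μ + (ENNReal.ofReal M * μ univ + ∫⁻ y, (-(g y)).toENNReal' ∂μ) ≤
      ∫⁻ y, (g y).toENNReal' ∂μ + ENNReal.ofReal (-M) * μ univ := by
    rw [← lintegral_const, ← lintegral_const, ← lintegral_add_right _ measurable_const,
      ← lintegral_add_left measurable_const, ← lintegral_add_left hf]
    exact lintegral_mono fun y => le_toENNReal'_add (hg y)
  have hM := ENNReal.mul_ne_top (ENNReal.ofReal_ne_top (r := M)) hS
  have hM' := ENNReal.mul_ne_top (ENNReal.ofReal_ne_top (r := -M)) hS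
  have hN : ∫⁻ y, (-(g y)).toENNReal' ∂μ ≠ ∞ := by
    refine ne_top_of_le_ne_top hM' ?_
    rw [← lintegral_const]
    refine lintegral_mono fun y => ?_
    rw [← hg y]
    generalize f y = φ
    induction φ with
    | top => simp [EReal.toENNReal']
    | coe p =>
      rw [show (M : EReal) + ((p : ℝ≥0∞) : EReal) = ((M + p : ℝ) : EReal) from rfl,
        ← EReal.coe_neg, toENNReal'_coe]
      exact ENNReal.ofReal_le_ofReal (by linarith [p.coe_nonneg])
  by_cases hP : ∫⁻ y, (g y).toENNReal' ∂μ = ∞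
  · rw [eIntegral, hP, ← EReal.coe_ennreal_toReal hN, EReal.coe_ennreal_top, EReal.top_sub_coe,
      EReal.coe_mul_top_of_pos (by positivity)]
    exact le_top
  have hL := ENNReal.add_ne_top.mpr ⟨hP, hM'⟩
  have hF : ∫⁻ y, f y ∂μ ≠ ∞ := ne_top_of_le_ne_top hL (le_self_add.trans key)
  have key' := ENNReal.toReal_mono hL key
  rw [ENNReal.toReal_add hP hM', ENNReal.toReal_add hF (ENNReal.add_ne_top.mpr ⟨hM, hN⟩),
    ENNReal.toReal_add hM hN, ENNReal.toReal_mul, ENNReal.toReal_mul, ENNReal.toReal_ofReal',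
    ENNReal.toReal_ofReal'] at key'
  rw [eIntegral_of_ne_top hP hN, ← EReal.coe_mul, EReal.coe_le_coe_iff, one_div,
    inv_mul_eq_div, le_div_iff₀ hSpos]
  rw [← ENNReal.ofReal_toReal hS, ← ENNReal.ofReal_mul' hSpos.le,
    ENNReal.ofReal_le_iff_le_toReal hF] at ha
  have hmax := max_zero_sub_eq_self M
  nlinarith

end Mean

section Gluing

variable {m : ℕ}

theorem sphereMeasure_univ (hm : 1 ≤ m) (x : Em m) {t : ℝ} (ht : 0 < t) :
    sphereMeasure m x t univ = ENNReal.ofReal (t ^ (m - 1)) * sphereMeasure m 0 1 univ := by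
  simpa using lintegral_sphereMeasure hm x ht (f := fun _ => 1) measurable_const

theorem sMean_eq (hm : 1 ≤ m) (v : Em m → EReal) (x : Em m) {t : ℝ} (ht : 0 < t) :
    sMean m v x t = ((1 / (sphereMeasure m x t univ).toReal : ℝ) : EReal) *
      eIntegral (sphereMeasure m x t) v := by
  rw [sMean, sphereMeasure_univ hm x ht, ENNReal.toReal_mul,
    ENNReal.toReal_ofReal (by positivity), mul_comm (t ^ (m - 1))]
  simp [sphereArea, sphereMeasure]

theorem isFiniteMeasure_sphereMeasure (hm : 1 ≤ m) (x : Em m) {t : ℝ} (ht : 0 < t) :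
    IsFiniteMeasure (sphereMeasure m x t) := by
  have := isFiniteMeasure_sphereMeasure_unit hm
  refine ⟨?_⟩
  rw [sphereMeasure_univ hm x ht]
  exact ENNReal.mul_lt_top ENNReal.ofReal_lt_top (measure_lt_top _ _)

theorem sphereMeasure_ne_zero (hm : 1 ≤ m) (x : Em m) {t : ℝ} (ht : 0 < t) :
    sphereMeasure m x t ≠ 0 := by
  rw [← Measure.measure_univ_ne_zero, sphereMeasure_univ hm x ht]
  exact mul_ne_zero (by simpa using pow_pos ht _) (sphereMeasure_unit_univ_pos hm).ne'

theorem mul_le_lintegral_sphereMeasure_iff (hm : 1 ≤ m) (x : Em m) {t : ℝ} (ht : 0 < t)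
    {f : Em m → ℝ≥0∞} (hf : Measurable f) (c : ℝ≥0∞) :
    c * sphereMeasure m x t univ ≤ ∫⁻ y, f y ∂sphereMeasure m x t ↔
      c * sphereMeasure m 0 1 univ ≤ ∫⁻ ω, f (x + t • ω) ∂sphereMeasure m 0 1 := by
  rw [lintegral_sphereMeasure hm x ht hf, sphereMeasure_univ hm x ht, mul_left_comm]
  exact ENNReal.mul_le_mul_iff_right (by simpa using pow_pos ht _) ENNReal.ofReal_ne_top

/-- The difference to a real lower bound, as an `ℝ≥0∞`-valued function, of an upper
semicontinuous function is upper semicontinuous. -/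
theorem upperSemicontinuous_sub_toENNReal {X : Type*} [TopologicalSpace X] {w : X → EReal}
    (hw : UpperSemicontinuous w) (M : ℝ) :
    UpperSemicontinuous fun x => (w x - M).toENNReal := by
  have hc : Continuous fun e : EReal => (e - M).toENNReal := by
    refine EReal.continuous_toENNReal.comp (continuous_iff_continuousAt.mpr fun e => ?_)
    simp only [sub_eq_add_neg, ← EReal.coe_neg]
    exact ContinuousAt.comp (f := fun y : EReal => (y, ((-M : ℝ) : EReal))) (x := e)
      (EReal.continuousAt_add (.inr (EReal.coe_ne_bot _)) (.inr (EReal.coe_ne_top _)))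
      (continuousAt_id.prodMk continuousAt_const)
  exact hc.comp_upperSemicontinuous hw fun a b h =>
    EReal.toENNReal_le_toENNReal (EReal.sub_le_sub h le_rfl)

theorem ordE_max_lt_top {V : Type*} [NormedAddCommGroup V] {v w : V → EReal} {M : ℝ} {r : ℝ}
    (hw : ∀ x, r < ‖x‖ → w x = max (v x) M)
    (h : ordE v < ⊤) : ordE w < ⊤ := by
  obtain ⟨C, hC, -⟩ := EReal.lt_iff_exists_real_btwn.mp h
  have hev := eventually_lt_of_limsup_lt hC
  refine lt_of_le_of_lt (limsup_le_of_le (a := ((C + Real.log (1 + max M 0) : ℝ) : EReal))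
    (by isBoundedDefault) ?_) (EReal.coe_lt_top _)
  have hlarge := (tendsto_norm_cobounded_atTop (E := V)).eventually
    (eventually_gt_atTop (max r (Real.exp 1)))
  filter_upwards [hev, hlarge] with x hx hxr
  have hlog : 1 ≤ Real.log ‖x‖ := by
    rw [Real.le_log_iff_exp_le (lt_trans (Real.exp_pos 1) ((le_max_right _ _).trans_lt hxr))]
    exact ((le_max_right _ _).trans_lt hxr).le
  rw [EReal.coe_lt_coe_iff, div_lt_iff₀ (by linarith)] at hx
  rw [EReal.coe_le_coe_iff, div_le_iff₀ (by linarith), hw x ((le_max_left _ _).trans_lt hxr)]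
  have hMlog : 0 ≤ Real.log (1 + max M 0) := Real.log_nonneg (by simp)
  have hmax : max (max (v x) M).toReal 0 ≤ max (v x).toReal 0 + max M 0 := by
    rcases max_choice (v x) (M : EReal) with h1 | h1 <;> rw [h1]
    · exact le_add_of_nonneg_right (le_max_right _ _)
    · exact le_add_of_nonneg_left (le_max_right _ _)
  have hprod : Real.log (1 + max (max (v x) M).toReal 0) ≤
      Real.log (1 + max (v x).toReal 0) + Real.log (1 + max M 0) := by
    have h1 : 0 ≤ max (v x).toReal 0 := le_max_right _ _
    have h2 : 0 ≤ max M 0 := le_max_right _ _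
    rw [← Real.log_mul (by positivity) (by positivity)]
    refine Real.log_le_log (by positivity) ?_
    nlinarith [mul_nonneg h1 h2]
  nlinarith

end Gluing

section RotationMean

theorem measure_inner_nonneg_ne_zero {E : Type*} [NormedAddCommGroup E]
    [InnerProductSpace ℝ E] [MeasurableSpace E] [BorelSpace E] {σ : Measure E} (hσ : σ ≠ 0)
    (hinv : ∀ e : E ≃ₗᵢ[ℝ] E, σ.map e = σ) (y : E) :
    σ {ω | 0 ≤ inner ℝ y ω} ≠ 0 := by
  intro h0
  have hcl : MeasurableSet {ω : E | 0 ≤ inner ℝ y ω} :=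
    (isClosed_le continuous_const (continuous_const.inner continuous_id)).measurableSet
  have h1 : σ {ω | 0 ≤ inner ℝ y (-ω)} = 0 := by
    have := hinv (LinearIsometryEquiv.neg ℝ)
    rw [← this, Measure.map_apply (LinearIsometryEquiv.continuous _).measurable] at h0
    · simpa using h0
    · exact hcl
  refine hσ (Measure.measure_univ_eq_zero.mp (measure_mono_null (fun ω _ => ?_)
    (measure_union_null h0 h1)))
  rcases le_total 0 (inner ℝ y ω) with h | h
  · exact Or.inl h
  · exact Or.inr (by simpa using h)

variable {E : Type*} [NormedAddCommGroup E] [InnerProductSpace ℝ E] [FiniteDimensional ℝ E]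

instance compactSpace_unitary : CompactSpace (unitary (E →L[ℝ] E)) := by
  have : ProperSpace (E →L[ℝ] E) := FiniteDimensional.proper_real _
  refine isCompact_iff_compactSpace.mp
    (Metric.isCompact_of_isClosed_isBounded isClosed_unitary ?_)
  refine (Metric.isBounded_closedBall (x := (0 : E →L[ℝ] E)) (r := 1)).subset fun u hu => ?_
  rw [mem_closedBall_zero_iff]
  exact ContinuousLinearMap.opNorm_le_bound _ zero_le_one fun x => by
    rw [ContinuousLinearMap.norm_map_of_mem_unitary hu, one_mul]

/-- The Haar probability measure on the orthogonal group. -/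
def orthogonalHaar (E : Type*) [NormedAddCommGroup E] [InnerProductSpace ℝ E]
    [FiniteDimensional ℝ E] : Measure (unitary (E →L[ℝ] E)) :=
  Measure.haarMeasure ⊤

instance : IsProbabilityMeasure (orthogonalHaar E) :=
  ⟨Measure.haarMeasure_self (K₀ := (⊤ : TopologicalSpace.PositiveCompacts _))⟩

instance : (orthogonalHaar E).IsMulLeftInvariant := by
  unfold orthogonalHaar; infer_instance

/-- The mean of `y ↦ f (x + y)` over the orbit of `y` under the orthogonal group. -/
def rotationMean (f : E → ℝ≥0∞) (x y : E) : ℝ≥0∞ :=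
  ∫⁻ g, f (x + ((g⁻¹ : unitary (E →L[ℝ] E)) : E →L[ℝ] E) y) ∂orthogonalHaar E

theorem exists_unitary_apply_eq {y z : E} (h : ‖y‖ = ‖z‖) :
    ∃ u : unitary (E →L[ℝ] E), (u : E →L[ℝ] E) y = z := by
  refine ⟨Unitary.linearIsometryEquiv.symm (Submodule.reflection (ℝ ∙ (y - z))ᗮ), ?_⟩
  rw [Unitary.coe_symm_linearIsometryEquiv_apply]
  exact Submodule.reflection_sub h

theorem rotationMean_eq_of_norm_eq (f : E → ℝ≥0∞) (x : E) {y z : E} (h : ‖y‖ = ‖z‖) :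
    rotationMean f x y = rotationMean f x z := by
  obtain ⟨u, rfl⟩ := exists_unitary_apply_eq h
  have h1 : ∀ g : unitary (E →L[ℝ] E), (((u * g)⁻¹ : unitary (E →L[ℝ] E)) : E →L[ℝ] E)
      ((u : E →L[ℝ] E) y) = ((g⁻¹ : unitary (E →L[ℝ] E)) : E →L[ℝ] E) y := fun g => by
    rw [← mul_apply_eq_comp, ← Submonoid.coe_mul, mul_inv_rev, inv_mul_cancel_right]
  have h2 := lintegral_mul_left_eq_self (μ := orthogonalHaar E)
    (fun g => f (x + ((g⁻¹ : unitary (E →L[ℝ] E)) : E →L[ℝ] E) ((u : E →L[ℝ] E) y))) u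
  simp only [h1] at h2
  exact h2

theorem rotationMean_zero (f : E → ℝ≥0∞) (x : E) : rotationMean f x 0 = f x := by
  simp [rotationMean]

theorem continuous_add_inv_apply (x : E) :
    Continuous fun p : unitary (E →L[ℝ] E) × E =>
      x + ((p.1⁻¹ : unitary (E →L[ℝ] E)) : E →L[ℝ] E) p.2 := by
  have h : Continuous fun p : unitary (E →L[ℝ] E) × E =>
      ((p.1⁻¹ : unitary (E →L[ℝ] E)) : E →L[ℝ] E) :=
    continuous_subtype_val.comp (continuous_inv.comp continuous_fst)
  exact continuous_const.add (h.clm_apply continuous_snd)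

theorem norm_unitary_apply (u : unitary (E →L[ℝ] E)) (y : E) : ‖(u : E →L[ℝ] E) y‖ = ‖y‖ :=
  ContinuousLinearMap.norm_map_of_mem_unitary u.2 y

theorem exists_forall_closedBall_le {f : E → ℝ≥0∞} (hf : UpperSemicontinuous f)
    (hfin : ∀ x, f x ≠ ∞) (x : E) {R : ℝ} (hR : 0 ≤ R) :
    ∃ C, C ≠ ∞ ∧ ∀ z ∈ closedBall x R, f z ≤ C := by
  obtain ⟨a, -, ha⟩ := (hf.upperSemicontinuousOn (closedBall x R)).exists_isMaxOn
    ⟨x, mem_closedBall_self hR⟩ (isCompact_closedBall x R)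
  exact ⟨f a, hfin a, fun z hz => ha hz⟩

theorem rotationMean_le {f : E → ℝ≥0∞} {x : E} {R : ℝ} {C : ℝ≥0∞}
    (h : ∀ z ∈ closedBall x R, f z ≤ C) {y : E} (hy : ‖y‖ ≤ R) : rotationMean f x y ≤ C := by
  calc rotationMean f x y ≤ ∫⁻ _, C ∂orthogonalHaar E :=
        lintegral_mono fun g => h _ (by simpa [norm_unitary_apply] using hy)
    _ = C := by simp

theorem upperSemicontinuous_rotationMean {f : E → ℝ≥0∞} (hf : UpperSemicontinuous f)
    (hfin : ∀ x, f x ≠ ∞) (x : E) : UpperSemicontinuous (rotationMean f x) := by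
  intro y c hc
  by_contra hcon
  obtain ⟨u, hu, huc⟩ := Filter.exists_seq_forall_of_frequently (not_eventually.mp hcon)
  have hball : ∀ᶠ n in atTop, u n ∈ closedBall y 1 :=
    hu (closedBall_mem_nhds y zero_lt_one)
  obtain ⟨N, hN⟩ := eventually_atTop.mp hball
  obtain ⟨C, hC, hfC⟩ := exists_forall_closedBall_le hf hfin x
    (add_nonneg (norm_nonneg y) zero_le_one)
  have hlim : Tendsto (fun n => u (n + N)) atTop (𝓝 y) := (tendsto_add_atTop_iff_nat N).mpr hu
  have key := limsup_lintegral_le (μ := orthogonalHaar E)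
    (f := fun n g => f (x + ((g⁻¹ : unitary (E →L[ℝ] E)) : E →L[ℝ] E) (u (n + N))))
    (fun _ => C)
    (fun n => (hf.comp ((continuous_add_inv_apply x).comp
      (Continuous.prodMk_left (u (n + N))))).measurable)
    (fun n => Eventually.of_forall fun g => hfC _ (by
      have h1 := hN (n + N) (Nat.le_add_left _ _)
      rw [mem_closedBall, dist_eq_norm] at h1
      rw [mem_closedBall, dist_self_add_left, norm_unitary_apply]
      calc ‖u (n + N)‖ = ‖y + (u (n + N) - y)‖ := by congr 1; abel
        _ ≤ ‖y‖ + 1 := (norm_add_le _ _).trans (by gcongr)))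
    (by simpa using hC)
  have hle : c ≤ rotationMean f x y := by
    refine le_trans ?_ (key.trans (lintegral_mono fun g => ?_))
    · exact le_limsup_of_frequently_le
        (Frequently.of_forall fun n => not_lt.mp (huc (n + N)))
    · refine le_trans ?_ (hf.limsup_le (x + ((g⁻¹ : unitary (E →L[ℝ] E)) : E →L[ℝ] E) y))
      have ht : Tendsto (fun n => x + ((g⁻¹ : unitary (E →L[ℝ] E)) : E →L[ℝ] E) (u (n + N)))
          atTop (𝓝 (x + ((g⁻¹ : unitary (E →L[ℝ] E)) : E →L[ℝ] E) y)) :=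
        tendsto_const_nhds.add ((ContinuousLinearMap.continuous _).tendsto y |>.comp hlim)
      exact limsup_le_limsup_of_le (f := map _ atTop) ht
  exact absurd hc (not_lt.mpr hle)

variable [MeasurableSpace E] [BorelSpace E]

theorem measurable_rotation_uncurry {f : E → ℝ≥0∞} (hf : UpperSemicontinuous f) (x : E)
    {φ : E → E} (hφ : Continuous φ) :
    Measurable fun p : unitary (E →L[ℝ] E) × E =>
      f (x + ((p.1⁻¹ : unitary (E →L[ℝ] E)) : E →L[ℝ] E) (φ p.2)) :=
  (hf.comp ((continuous_add_inv_apply x).comp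
    (continuous_fst.prodMk (hφ.comp continuous_snd)))).measurable

theorem lintegral_unitary_apply {σ : Measure E}
    (hinv : ∀ e : E ≃ₗᵢ[ℝ] E, σ.map e = σ) (F : E → ℝ≥0∞) (u : unitary (E →L[ℝ] E)) :
    ∫⁻ ω, F ((u : E →L[ℝ] E) ω) ∂σ = ∫⁻ ω, F ω ∂σ := by
  conv_rhs => rw [← hinv (Unitary.linearIsometryEquiv u)]
  exact (lintegral_map_equiv F
    (Unitary.linearIsometryEquiv u).toHomeomorph.toMeasurableEquiv).symm

theorem lintegral_rotationMean {σ : Measure E} [IsFiniteMeasure σ] {f : E → ℝ≥0∞}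
    (hf : UpperSemicontinuous f) (x : E) {φ : E → E} (hφ : Continuous φ) :
    ∫⁻ ω, rotationMean f x (φ ω) ∂σ =
      ∫⁻ g, ∫⁻ ω, f (x + ((g⁻¹ : unitary (E →L[ℝ] E)) : E →L[ℝ] E) (φ ω)) ∂σ
        ∂orthogonalHaar E :=
  (lintegral_lintegral_swap (measurable_rotation_uncurry hf x hφ).aemeasurable).symm

/-- Averaging over the sphere of radius `t` factors through the rotation mean. -/
theorem rotationMean_mul_eq_lintegral {σ : Measure E} [IsFiniteMeasure σ]
    (hsph : ∀ᵐ ω ∂σ, ‖ω‖ = 1) (hinv : ∀ e : E ≃ₗᵢ[ℝ] E, σ.map e = σ) {f : E → ℝ≥0∞}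
    (hf : UpperSemicontinuous f) (x : E) {y : E} :
    rotationMean f x y * σ univ = ∫⁻ ω, f (x + ‖y‖ • ω) ∂σ := by
  have h1 : ∫⁻ ω, rotationMean f x (‖y‖ • ω) ∂σ = rotationMean f x y * σ univ := by
    rw [← lintegral_const]
    refine lintegral_congr_ae (hsph.mono fun ω hω => ?_)
    exact rotationMean_eq_of_norm_eq f x (by simp [norm_smul, hω])
  rw [← h1, lintegral_rotationMean hf x (continuous_const_smul ‖y‖)]
  have h2 : ∀ g : unitary (E →L[ℝ] E),
      ∫⁻ ω, f (x + ((g⁻¹ : unitary (E →L[ℝ] E)) : E →L[ℝ] E) (‖y‖ • ω)) ∂σ =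
        ∫⁻ ω, f (x + ‖y‖ • ω) ∂σ := fun g => by
    rw [← lintegral_unitary_apply hinv (fun ω => f (x + ‖y‖ • ω)) g⁻¹]
    simp
  simp only [h2, lintegral_const, measure_univ, mul_one]

theorem rotationMean_mul_le_lintegral {σ : Measure E} [IsFiniteMeasure σ]
    (hinv : ∀ e : E ≃ₗᵢ[ℝ] E, σ.map e = σ) {f : E → ℝ≥0∞}
    (hf : UpperSemicontinuous f) {δ : ℝ}
    (hloc : ∀ z, f z * σ univ ≤ ∫⁻ ω, f (z + δ • ω) ∂σ) (x y : E) :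
    rotationMean f x y * σ univ ≤ ∫⁻ ω, rotationMean f x (y + δ • ω) ∂σ := by
  rw [lintegral_rotationMean hf x (φ := fun ω => y + δ • ω) (by fun_prop),
    rotationMean, ← lintegral_mul_const' _ _ (measure_ne_top σ univ)]
  refine lintegral_mono fun g => (hloc _).trans_eq ?_
  rw [← lintegral_unitary_apply hinv _ g⁻¹]
  simp [add_assoc]

/-- An upper semicontinuous function satisfying the sub-mean inequality at all small radii
satisfies it at every radius. -/
theorem submean_of_submean_small {σ : Measure E} [IsFiniteMeasure σ] (hσ : σ ≠ 0)
    (hsph : ∀ᵐ ω ∂σ, ‖ω‖ = 1) (hinv : ∀ e : E ≃ₗᵢ[ℝ] E, σ.map e = σ) {f : E → ℝ≥0∞}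
    (hf : UpperSemicontinuous f) (hfin : ∀ x, f x ≠ ∞) {δ₀ : ℝ} (hδ₀ : 0 < δ₀)
    (hloc : ∀ z δ, 0 < δ → δ ≤ δ₀ → f z * σ univ ≤ ∫⁻ ω, f (z + δ • ω) ∂σ)
    (x : E) {t : ℝ} (ht : 0 < t) :
    f x * σ univ ≤ ∫⁻ ω, f (x + t • ω) ∂σ := by
  obtain ⟨C, hC, hfC⟩ := exists_forall_closedBall_le hf hfin x ht.le
  have husc := upperSemicontinuous_rotationMean hf hfin x
  obtain ⟨a, ha, hmax⟩ := (husc.upperSemicontinuousOn (closedBall 0 t)).exists_isMaxOn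
    ⟨0, mem_closedBall_self ht.le⟩ (isCompact_closedBall (0 : E) t)
  obtain ⟨y, ⟨hyt, hya⟩, hy⟩ := (((isCompact_closedBall (0 : E) t).inter_right
    (husc.isClosed_preimage (rotationMean f x a))).exists_isMaxOn
      ⟨a, ha, mem_preimage.mpr self_mem_Ici⟩ continuous_norm.continuousOn)
  have hya : rotationMean f x a ≤ rotationMean f x y := hya
  have hymax : ∀ z ∈ closedBall (0 : E) t, rotationMean f x z ≤ rotationMean f x y :=
    fun z hz => (hmax hz).trans hya
  rw [mem_closedBall_zero_iff] at hyt
  have hyC : rotationMean f x y ≠ ∞ := ((rotationMean_le hfC hyt).trans_lt hC.lt_top).ne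
  have hnorm : ‖y‖ = t := by
    refine hyt.antisymm (not_lt.mp fun hlt => ?_)
    set δ := min δ₀ (t - ‖y‖) with hδ
    have hδpos : 0 < δ := lt_min hδ₀ (sub_pos.mpr hlt)
    have hsub := rotationMean_mul_le_lintegral hinv hf
      (fun z => hloc z δ hδpos (min_le_left _ _)) x y
    have hball : ∀ ω : E, ‖ω‖ = 1 → y + δ • ω ∈ closedBall (0 : E) t := fun ω hω => by
      rw [mem_closedBall_zero_iff]
      have h1 := norm_add_le y (δ • ω)
      rw [norm_smul, hω, Real.norm_of_nonneg hδpos.le] at h1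
      linarith [min_le_right δ₀ (t - ‖y‖)]
    have hstrict : ∫⁻ ω, rotationMean f x (y + δ • ω) ∂σ <
        ∫⁻ _, rotationMean f x y ∂σ := by
      refine lintegral_strict_mono_of_ae_le_of_frequently_ae_lt aemeasurable_const ?_
        (hsph.mono fun ω hω => hymax _ (hball ω hω)) ?_
      · refine ne_top_of_le_ne_top (b := ∫⁻ _, rotationMean f x y ∂σ) ?_
          (lintegral_mono_ae (hsph.mono fun ω hω => hymax _ (hball ω hω)))
        simpa using ENNReal.mul_ne_top hyC (measure_ne_top σ univ)
      · have hfreq : ∃ᵐ ω ∂σ, 0 ≤ inner ℝ y ω :=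
          frequently_ae_iff.mpr (measure_inner_nonneg_ne_zero hσ hinv y)
        refine (hfreq.and_eventually hsph).mono fun ω hω heq => ?_
        have h1 : ‖y + δ • ω‖ ≤ ‖y‖ := hy ⟨hball ω hω.2, by
          rwa [mem_preimage, mem_Ici, heq]⟩
        have h2 := norm_add_sq_real y (δ • ω)
        rw [inner_smul_right, norm_smul, hω.2, Real.norm_of_nonneg hδpos.le] at h2
        nlinarith [mul_nonneg hδpos.le hω.1, norm_nonneg (y + δ • ω), norm_nonneg y]
    rw [lintegral_const] at hstrict
    exact absurd hstrict (not_lt.mpr hsub)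
  rw [← hnorm, ← rotationMean_mul_eq_lintegral hsph hinv hf x]
  gcongr
  rw [← rotationMean_zero f x]
  exact hymax 0 (mem_closedBall_self ht.le)

end RotationMean

/-- Gluing lemma: for a subharmonic function `v` on `ℝᵐ \ B̄(0, r₀)` with
`M₀ := sup_{B̄(0,r₁) \ B̄(0,r₀)} v` finite, the function equal to `M₀` on `B̄(0,r₁)` and to
`max{v, M₀}` outside is subharmonic on all of `ℝᵐ`; if moreover `v` has finite order then
so does the glued function. -/
theorem glued_function_subharmonic (m : ℕ) (hm : 1 ≤ m) (r₀ r₁ : ℝ)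
    (hr₀ : 0 ≤ r₀) (hr₀₁ : r₀ < r₁)
    (v : Em m → EReal)
    (hsub : SubharmonicOn m v (Metric.closedBall (0 : Em m) r₀)ᶜ)
    (M₀ : EReal)
    (hM₀ : M₀ = sSup (v '' (Metric.closedBall (0 : Em m) r₁ \ Metric.closedBall (0 : Em m) r₀)))
    (hM₀top : M₀ ≠ ⊤) (hM₀bot : M₀ ≠ ⊥)
    (w : Em m → EReal)
    (hw : ∀ x, w x =
      if x ∈ Metric.closedBall (0 : Em m) r₁ then M₀ else max (v x) M₀) :
    SubharmonicOn m w Set.univ ∧ (ordE v < ⊤ → ordE w < ⊤) := by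
  lift M₀ to ℝ using ⟨hM₀top, hM₀bot⟩ with M
  obtain ⟨hvusc, hvtop, hvmean⟩ := hsub
  have hUopen : IsOpen (closedBall (0 : Em m) r₀)ᶜ := isClosed_closedBall.isOpen_compl
  have hwU : ∀ x ∈ (closedBall (0 : Em m) r₀)ᶜ, w x = max (v x) M := fun x hx => by
    rw [hw]
    split_ifs with h
    · exact (max_eq_right (hM₀ ▸ le_sSup (mem_image_of_mem v ⟨h, hx⟩))).symm
    · rfl
  have hwM : ∀ x, (M : EReal) ≤ w x := fun x => by
    rw [hw]
    split_ifs
    exacts [le_rfl, le_max_right _ _]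
  have hcompl : ∀ x, x ∉ closedBall (0 : Em m) r₁ → x ∈ (closedBall (0 : Em m) r₀)ᶜ :=
    fun x hx hx' => hx (closedBall_subset_closedBall hr₀₁.le hx')
  have hwtop : ∀ x, w x ≠ ⊤ := fun x => by
    rw [hw]
    split_ifs with h
    · exact EReal.coe_ne_top M
    · exact (max_lt (hvtop x (hcompl x h)).lt_top (EReal.coe_lt_top M)).ne
  have hwusc : UpperSemicontinuous w := fun x c hc => by
    replace hc : w x < c := hc
    change ∀ᶠ y in 𝓝 x, w y < c
    by_cases hx : x ∈ closedBall (0 : Em m) r₀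
    · filter_upwards [isOpen_ball.mem_nhds
        (mem_ball.mpr ((mem_closedBall.mp hx).trans_lt hr₀₁))] with y hy
      rw [hw, if_pos (ball_subset_closedBall hy)]
      exact (hwM x).trans_lt hc
    · rw [hwU x hx, max_lt_iff] at hc
      have h1 := hvusc x hx c hc.1
      rw [hUopen.nhdsWithin_eq hx] at h1
      filter_upwards [h1, hUopen.mem_nhds hx] with y hy hyU
      rw [hwU y hyU]
      exact max_lt hy hc.2
  set f : Em m → ℝ≥0∞ := fun x => (w x - M).toENNReal with hf
  have hfusc : UpperSemicontinuous f := upperSemicontinuous_sub_toENNReal hwusc M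
  have hwreal : ∀ x, ∃ a : ℝ, w x = a ∧ f x = ENNReal.ofReal (a - M) := fun x => by
    have hbot : w x ≠ ⊥ := ((EReal.bot_lt_coe M).trans_le (hwM x)).ne'
    refine ⟨(w x).toReal, (EReal.coe_toReal (hwtop x) hbot).symm, ?_⟩
    rw [← EReal.real_coe_toENNReal, EReal.coe_sub, EReal.coe_toReal (hwtop x) hbot]
  have hwf : ∀ x, (M : EReal) + f x = w x := fun x => by
    obtain ⟨a, ha, hfa⟩ := hwreal x
    have hMa : M ≤ a := EReal.coe_le_coe_iff.mp (ha ▸ hwM x)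
    rw [hfa, ha, EReal.coe_ennreal_ofReal, max_eq_left (sub_nonneg.mpr hMa), ← EReal.coe_add,
      add_sub_cancel]
  have hffin : ∀ x, f x ≠ ∞ := fun x => by
    obtain ⟨a, -, hfa⟩ := hwreal x
    exact hfa ▸ ENNReal.ofReal_ne_top
  have hloc : ∀ z δ, 0 < δ → δ ≤ (r₁ - r₀) / 2 → f z * sphereMeasure m 0 1 univ ≤
      ∫⁻ ω, f (z + δ • ω) ∂sphereMeasure m 0 1 := fun z δ hδ hδr => by
    have := isFiniteMeasure_sphereMeasure hm z hδ
    obtain ⟨a, ha, hfa⟩ := hwreal z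
    rcases (hwM z).eq_or_lt with hz | hz
    · have : f z = 0 := EReal.toENNReal_of_nonpos (by simp [← hz])
      simp [this]
    have hz₁ : z ∉ closedBall (0 : Em m) r₁ := fun h => by
      rw [hw, if_pos h] at hz
      exact lt_irrefl _ hz
    have hsubset : closedBall z δ ⊆ (closedBall (0 : Em m) r₀)ᶜ := fun y hy hy₀ => by
      rw [mem_closedBall] at hy hy₀ hz₁
      rw [dist_comm] at hy
      linarith [dist_triangle z y 0]
    have hvz : v z = a := by
      rw [hwU z (hcompl z hz₁)] at ha hz
      rcases max_choice (v z) (M : EReal) with h | h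
      · rw [← ha, h]
      · exact absurd hz (by simp [h])
    rw [← mul_le_lintegral_sphereMeasure_iff hm z hδ hfusc.measurable, hfa]
    refine ofReal_sub_mul_le_lintegral (sphereMeasure_ne_zero hm z hδ) (g := v)
      hfusc.measurable ?_ ?_
    · refine (ae_restrict_iff' isClosed_sphere.measurableSet).mpr (Eventually.of_forall ?_)
      intro y hy
      rw [hwf, hwU y (hsubset (sphere_subset_closedBall hy))]
      exact le_max_left _ _
    · rw [← hvz, ← sMean_eq hm v z hδ]
      exact hvmean z (hcompl z hz₁) δ hδ hsubset
  refine ⟨⟨upperSemicontinuousOn_univ_iff.mpr hwusc, fun x _ => hwtop x, fun x _ t ht _ => ?_⟩,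
    ordE_max_lt_top fun x hx => hwU x (by simpa using hx)⟩
  have := isFiniteMeasure_sphereMeasure hm x ht
  have := isFiniteMeasure_sphereMeasure_unit hm
  obtain ⟨a, ha, hfa⟩ := hwreal x
  rw [ha, sMean_eq hm w x ht]
  refine le_mul_eIntegral (sphereMeasure_ne_zero hm x ht) hfusc.measurable hwf ?_
  rw [← hfa, mul_le_lintegral_sphereMeasure_iff hm x ht hfusc.measurable]
  refine submean_of_submean_small (sphereMeasure_ne_zero hm 0 one_pos) ?_ sphereMeasure_unit_map
    hfusc hffin (half_pos (sub_pos.mpr hr₀₁)) hloc x ht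
  exact (ae_restrict_iff' isClosed_sphere.measurableSet).mpr
    (Eventually.of_forall fun ω hω => mem_sphere_zero_iff_norm.mp hω)
end
end
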